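/- Let {f_ε}_{0≤ε≤ε₀} be a good family with power law exponent γ > 1, and for each ε let Λ_ε = {x ∈ [-1,1] : f_εⁿ(x) ∈ [-1,1] for all n ≥ 0} be the maximal invariant set. Then for every 0 < ε ≤ ε₀ the set Λ_ε is a Cantor set (nonempty, compact, perfect and totally disconnected), and the function ε^{1/γ} determines asymptotically the gap geometry of the family: there is a constant C > 0 such that for all 0 < ε ≤ ε₀, all finite binary strings w, and i = 0 or 1, one has C^{-1}ε^{1/γ} ≤ |G_{ε,w}|/|I_{ε,w}| ≤ Cε^{1/γ} and |I_{ε,wi}|/|I_{ε,w}| ≥ C^{-1}. -/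

import Mathlib

open Set MeasureTheory Filter Topology

noncomputable def len (s : Set ℝ) : ℝ := (volume s).toReal

noncomputable def branch (f : ℝ → ℝ) : Bool → ℝ → ℝ
  | false => Function.invFunOn f (Icc (-1) 0)
  | true => Function.invFunOn f (Icc 0 1)

noncomputable def gw (f : ℝ → ℝ) : List Bool → ℝ → ℝ
  | [] => id
  | b :: w => branch f b ∘ gw f w

noncomputable def Iw (f : ℝ → ℝ) (w : List Bool) : Set ℝ := gw f w '' Icc (-1) 1

def word (a : ℕ → Bool) (n : ℕ) : List Bool := ((List.range (n + 1)).reverse).map a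

noncomputable def ratio (f : ℝ → ℝ) (a : ℕ → Bool) (n : ℕ) : ℝ :=
  len (Iw f (word a n)) / len (Iw f ((word a n).dropLast))

def IsScalingFun (f : ℝ → ℝ) (s : (ℕ → Bool) → ℝ) : Prop :=
  ∀ a : ℕ → Bool, Tendsto (ratio f a) atTop (nhds (s a))

def HolderOnDual (s : (ℕ → Bool) → ℝ) : Prop :=
  ∃ C > (0:ℝ), ∃ lam ∈ Ioo (0:ℝ) 1, ∀ a b : ℕ → Bool, ∀ n : ℕ,
    (∀ k < n, a k = b k) → |s a - s b| ≤ C * lam ^ n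

def EvZero (a : ℕ → Bool) : Prop := ∃ N, ∀ n ≥ N, a n = false

def Lambda (f : ℝ → ℝ) : Set ℝ := {x | ∀ n : ℕ, f^[n] x ∈ Icc (-1) 1}

structure GoodFamily where
  eps0 : ℝ
  eps0_pos : 0 < eps0
  f : ℝ → ℝ → ℝ
  f' : ℝ → ℝ → ℝ
  gamma : ℝ
  one_lt_gamma : 1 < gamma
  mono : ∀ ε ∈ Icc 0 eps0, StrictMonoOn (f ε) (Icc (-1) 0)
  anti : ∀ ε ∈ Icc 0 eps0, StrictAntiOn (f ε) (Icc 0 1)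
  map_neg_one : ∀ ε ∈ Icc 0 eps0, f ε (-1) = -1
  map_one : ∀ ε ∈ Icc 0 eps0, f ε 1 = -1
  map_zero : ∀ ε ∈ Icc 0 eps0, f ε 0 = 1 + ε
  smooth : ContDiffOn ℝ 1 (fun p : ℝ × ℝ => f p.1 p.2) (Icc 0 eps0 ×ˢ Icc (-1) 1)
  deriv_f : ∀ ε ∈ Icc 0 eps0, ∀ x ∈ Icc (-1:ℝ) 1,
    HasDerivWithinAt (f ε) (f' ε x) (Icc (-1) 1) x
  Rneg : ℝ → ℝ → ℝ
  Rpos : ℝ → ℝ → ℝ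
  Rneg_cont : ContinuousOn (fun p : ℝ × ℝ => Rneg p.1 p.2) (Icc 0 eps0 ×ˢ Icc (-1) 0)
  Rpos_cont : ContinuousOn (fun p : ℝ × ℝ => Rpos p.1 p.2) (Icc 0 eps0 ×ˢ Icc 0 1)
  Rneg_ne : ∀ ε ∈ Icc 0 eps0, ∀ x ∈ Icc (-1:ℝ) 0, Rneg ε x ≠ 0
  Rpos_ne : ∀ ε ∈ Icc 0 eps0, ∀ x ∈ Icc (0:ℝ) 1, Rpos ε x ≠ 0
  Rneg_eq : ∀ ε ∈ Icc 0 eps0, ∀ x ∈ Ico (-1:ℝ) 0, Rneg ε x = f' ε x / |x| ^ (gamma - 1)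
  Rpos_eq : ∀ ε ∈ Icc 0 eps0, ∀ x ∈ Ioc (0:ℝ) 1, Rpos ε x = f' ε x / |x| ^ (gamma - 1)
  K' : ℝ
  K'_pos : 0 < K'
  alpha' : ℝ
  alpha'_mem : alpha' ∈ Ioc (0:ℝ) 1
  holder' : ∀ ε ∈ Icc 0 eps0, ∀ x ∈ Icc (-1:ℝ) 1, ∀ y ∈ Icc (-1:ℝ) 1,
    |f' ε x - f' ε y| ≤ K' * |x - y| ^ alpha'
  K'' : ℝ
  K''_pos : 0 < K''
  alpha'' : ℝ
  alpha''_mem : alpha'' ∈ Ioc (0:ℝ) 1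
  holder''_neg : ∀ ε ∈ Icc 0 eps0, ∀ x ∈ Ico (-1:ℝ) 0, ∀ y ∈ Ico (-1:ℝ) 0,
    |f' ε x / |x| ^ (gamma - 1) - f' ε y / |y| ^ (gamma - 1)| ≤ K'' * |x - y| ^ alpha''
  holder''_pos : ∀ ε ∈ Icc 0 eps0, ∀ x ∈ Ioc (0:ℝ) 1, ∀ y ∈ Ioc (0:ℝ) 1,
    |f' ε x / |x| ^ (gamma - 1) - f' ε y / |y| ^ (gamma - 1)| ≤ K'' * |x - y| ^ alpha''
  C0 : ℝ
  C0_pos : 0 < C0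
  lam : ℝ
  lam_mem : lam ∈ Ioo (0:ℝ) 1
  decay : ∀ ε ∈ Icc 0 eps0, ∀ n : ℕ, 1 ≤ n → ∀ w : List Bool, w.length = n + 1 →
    len (Iw (f ε) w) ≤ C0 * lam ^ n

/-- The gap `G_w` on the interval `I_w`: the complement in `I_w` of the two intervals
`I_{w0}` and `I_{w1}` of the next partition. -/
noncomputable def gap (f : ℝ → ℝ) (w : List Bool) : Set ℝ :=
  Iw f w \ (Iw f (w ++ [false]) ∪ Iw f (w ++ [true]))

/-! ### Quotients by a power law -/

theorem abs_log_sub_log_le {a b m : ℝ} (hm : 0 < m) (ha : m ≤ a) (hb : m ≤ b) :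
    |Real.log a - Real.log b| ≤ |a - b| / m := by
  wlog hab : b ≤ a generalizing a b
  · rw [abs_sub_comm, abs_sub_comm a b]
    exact this hb ha (le_of_not_ge hab)
  have hb0 : 0 < b := hm.trans_le hb
  have ha0 : 0 < a := hm.trans_le ha
  have hlog : Real.log b ≤ Real.log a := Real.log_le_log hb0 hab
  rw [abs_of_nonneg (by linarith), abs_of_nonneg (by linarith), ← Real.log_div ha0.ne' hb0.ne']
  calc Real.log (a / b) ≤ a / b - 1 := Real.log_le_sub_one_of_pos (by positivity)
    _ = (a - b) / b := by field_simp
    _ ≤ (a - b) / m := by gcongr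

theorem hasDerivAt_rpow_of_pos {p x : ℝ} (hx : 0 < x) :
    HasDerivAt (fun y : ℝ => y ^ p) (p * x ^ (p - 1)) x :=
  Real.hasDerivAt_rpow_const (Or.inl hx.ne')

theorem exists_eq_div_rpow {p u v : ℝ} {φ r : ℝ → ℝ} (hp : 1 ≤ p) (hv : 0 ≤ v) (hvu : v < u)
    (hφ : ContinuousOn φ (Icc v u))
    (hd : ∀ z ∈ Ioo v u, HasDerivAt φ (z ^ (p - 1) * r z) z) :
    ∃ ξ ∈ Ioo v u, φ u - φ v = (u ^ p - v ^ p) * (r ξ / p) := by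
  obtain ⟨ξ, hξ, h⟩ := exists_ratio_hasDerivAt_eq_ratio_slope φ (fun z => z ^ (p - 1) * r z) hvu hφ
    hd (fun z : ℝ => z ^ p) (fun z : ℝ => p * z ^ (p - 1))
    (fun z _ => (Real.continuousAt_rpow_const z p (Or.inr (by linarith))).continuousWithinAt)
    (fun z hz => hasDerivAt_rpow_of_pos (hv.trans_lt hz.1))
  refine ⟨ξ, hξ, ?_⟩
  have hpos : 0 < ξ ^ (p - 1) := Real.rpow_pos_of_pos (hv.trans_lt hξ.1) _
  have hp0 : p ≠ 0 := by linarith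
  have h' : (u ^ p - v ^ p) * r ξ = (φ u - φ v) * p :=
    mul_right_cancel₀ hpos.ne' (by linear_combination h)
  field_simp
  linarith

theorem abs_div_rpow_sub_le {p K α : ℝ} {φ r : ℝ → ℝ} (hp : 1 ≤ p) (hK : 0 ≤ K) (hα : 0 < α)
    (hφ : ContinuousOn φ (Icc 0 1)) (h0 : φ 0 = 0)
    (hd : ∀ z ∈ Ioo (0 : ℝ) 1, HasDerivAt φ (z ^ (p - 1) * r z) z)
    (hr : ∀ u ∈ Ioo (0 : ℝ) 1, ∀ v ∈ Ioo (0 : ℝ) 1, |r u - r v| ≤ K * |u - v| ^ α)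
    {u v : ℝ} (hu : u ∈ Ioo (0 : ℝ) 1) (hv : v ∈ Ioo (0 : ℝ) 1) :
    |φ u / u ^ p - φ v / v ^ p| ≤ K * |u - v| ^ α := by
  wlog hvu : v < u generalizing u v
  · rcases (not_lt.1 hvu).eq_or_lt with h | h
    · subst h; simp only [sub_self, abs_zero]; positivity
    · rw [abs_sub_comm, abs_sub_comm u v]
      exact this hv hu h
  set s := v / u with hs
  have hs0 : 0 < s := div_pos hv.1 hu.1
  have hs1 : s < 1 := (div_lt_one hu.1).2 hvu
  have hsu : s * u = v := div_mul_cancel₀ _ hu.1.ne'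
  have hmem : ∀ z ∈ Icc 0 u, s * z ∈ Icc (0 : ℝ) 1 := fun z hz =>
    ⟨mul_nonneg hs0.le hz.1, by nlinarith [hz.1, hz.2, hu.2]⟩
  have hmem' : ∀ z ∈ Ioo 0 u, s * z ∈ Ioo (0 : ℝ) 1 := fun z hz =>
    ⟨mul_pos hs0 hz.1, by nlinarith [hz.1, hz.2, hu.2]⟩
  have hsp : 0 < s ^ p := Real.rpow_pos_of_pos hs0 _
  obtain ⟨ξ, hξ, h⟩ := exists_eq_div_rpow (p := p) (φ := fun z => φ z - φ (s * z) / s ^ p)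
    (r := fun z => r z - r (s * z)) hp le_rfl hu.1
    ((hφ.mono (Icc_subset_Icc_right hu.2.le)).sub
      ((hφ.comp (continuousOn_const.mul continuousOn_id) hmem).div_const _))
    (fun z hz => by
      have h1 := hd z ⟨hz.1, hz.2.trans hu.2⟩
      have h2 := (((hd (s * z) (hmem' z hz)).comp z
        ((hasDerivAt_id z).const_mul s)).div_const (s ^ p))
      refine (h1.sub h2).congr_deriv ?_
      have hsp1 : s ^ p = s ^ (p - 1) * s := by
        rw [Real.rpow_sub_one hs0.ne', div_mul_cancel₀ _ hs0.ne']
      have : s ^ (p - 1) ≠ 0 := (Real.rpow_pos_of_pos hs0 _).ne'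
      rw [Real.mul_rpow hs0.le hz.1.le, hsp1]
      field_simp)
  have hup : 0 < u ^ p := Real.rpow_pos_of_pos hu.1 _
  have hvp : v ^ p = s ^ p * u ^ p := by rw [← hsu, Real.mul_rpow hs0.le hu.1.le]
  simp only [mul_zero, h0, zero_div, sub_zero, hsu, Real.zero_rpow (by linarith : p ≠ 0)] at h
  have key : φ u / u ^ p - φ v / v ^ p = (r ξ - r (s * ξ)) / p := by
    rw [hvp, ← mul_right_inj' hup.ne', ← h]
    field_simp
  rw [key, abs_div, abs_of_pos (by linarith : 0 < p)]
  have hle : |ξ - s * ξ| ≤ |u - v| := by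
    rw [← hsu, abs_of_pos (by nlinarith [hξ.1]), abs_of_pos (by nlinarith [hu.1])]
    nlinarith [hξ.2]
  calc |r ξ - r (s * ξ)| / p ≤ |r ξ - r (s * ξ)| := div_le_self (abs_nonneg _) hp
    _ ≤ K * |ξ - s * ξ| ^ α := hr _ ⟨hξ.1, hξ.2.trans hu.2⟩ _ (hmem' ξ hξ)
    _ ≤ K * |u - v| ^ α := by gcongr

/-! ### One side of a folding map

`h` is the map read on one side of its turning point, as a function of the distance to it. -/

structure HalfBranch (γ ε m M K α : ℝ) (h r : ℝ → ℝ) : Prop where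
  one_lt : 1 < γ
  m_pos : 0 < m
  K_nonneg : 0 ≤ K
  α_pos : 0 < α
  cont : ContinuousOn h (Icc 0 1)
  zero : h 0 = 1 + ε
  one : h 1 = -1
  deriv : ∀ u ∈ Ioo (0 : ℝ) 1, HasDerivAt h (-(u ^ (γ - 1) * r u)) u
  lower : ∀ u ∈ Ioo (0 : ℝ) 1, m ≤ r u
  upper : ∀ u ∈ Ioo (0 : ℝ) 1, r u ≤ M
  holder : ∀ u ∈ Ioo (0 : ℝ) 1, ∀ v ∈ Ioo (0 : ℝ) 1, |r u - r v| ≤ K * |u - v| ^ α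
  holder_deriv : ∀ u ∈ Ioo (0 : ℝ) 1, ∀ v ∈ Ioo (0 : ℝ) 1,
    |u ^ (γ - 1) * r u - v ^ (γ - 1) * r v| ≤ K * |u - v| ^ α

namespace HalfBranch

variable {γ ε m M K α : ℝ} {h r : ℝ → ℝ}

theorem strictAntiOn (H : HalfBranch γ ε m M K α h r) : StrictAntiOn h (Icc 0 1) := by
  refine strictAntiOn_of_hasDerivWithinAt_neg (f' := fun u => -(u ^ (γ - 1) * r u))
    (convex_Icc 0 1) H.cont ?_ ?_
  · rw [interior_Icc]
    exact fun u hu => (H.deriv u hu).hasDerivWithinAt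
  · rw [interior_Icc]
    exact fun u hu => neg_neg_of_pos
      (mul_pos (Real.rpow_pos_of_pos hu.1 _) (H.m_pos.trans_le (H.lower u hu)))

/-- The power law for the values near the turning point. -/
theorem mean_value (H : HalfBranch γ ε m M K α h r) {u v : ℝ} (hv : 0 ≤ v) (hvu : v < u)
    (hu : u ≤ 1) : ∃ ξ ∈ Ioo (0 : ℝ) 1, h v - h u = (u ^ γ - v ^ γ) * (r ξ / γ) := by
  obtain ⟨ξ, hξ, e⟩ := exists_eq_div_rpow (p := γ) (φ := fun z => -h z) (r := r) H.one_lt.le hv hvu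
    (H.cont.mono (Icc_subset_Icc hv hu)).neg
    (fun z hz => (H.deriv z ⟨hv.trans_lt hz.1, hz.2.trans_le hu⟩).neg.congr_deriv (neg_neg _))
  exact ⟨ξ, ⟨hv.trans_lt hξ.1, hξ.2.trans_le hu⟩, by linarith⟩

theorem lower_top (H : HalfBranch γ ε m M K α h r) {u : ℝ} (hu : u ∈ Ioc (0 : ℝ) 1) :
    m / γ * u ^ γ ≤ 1 + ε - h u := by
  have hγ := H.one_lt
  obtain ⟨ξ, hξ, e⟩ := H.mean_value le_rfl hu.1 hu.2
  rw [H.zero, Real.zero_rpow (by linarith), sub_zero] at e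
  rw [e, mul_comm]
  have := H.lower ξ hξ
  have := Real.rpow_pos_of_pos hu.1 γ
  gcongr

theorem upper_top (H : HalfBranch γ ε m M K α h r) {u : ℝ} (hu : u ∈ Ioc (0 : ℝ) 1) :
    1 + ε - h u ≤ M / γ * u ^ γ := by
  have hγ := H.one_lt
  obtain ⟨ξ, hξ, e⟩ := H.mean_value le_rfl hu.1 hu.2
  rw [H.zero, Real.zero_rpow (by linarith), sub_zero] at e
  rw [e, mul_comm (M / γ)]
  have := H.upper ξ hξ
  have := Real.rpow_pos_of_pos hu.1 γ
  gcongr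

theorem lower_bot (H : HalfBranch γ ε m M K α h r) {u : ℝ} (hu : u ∈ Ioo (0 : ℝ) 1) :
    m / γ * (1 - u) ≤ 1 + h u := by
  have hγ := H.one_lt
  obtain ⟨ξ, hξ, e⟩ := H.mean_value hu.1.le hu.2 le_rfl
  rw [H.one, Real.one_rpow] at e
  have h1 : u ^ γ ≤ u := by
    simpa using Real.rpow_le_rpow_of_exponent_ge hu.1 hu.2.le hγ.le
  have := H.lower ξ hξ
  have := H.m_pos
  have h2 : m / γ ≤ r ξ / γ := by gcongr
  have h3 : 0 < m / γ := by positivity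
  have h4 := hu.2
  calc m / γ * (1 - u) ≤ r ξ / γ * (1 - u ^ γ) := by
        apply mul_le_mul h2 (by linarith) (by linarith) (by linarith)
    _ = 1 + h u := by linarith

theorem upper_bot (H : HalfBranch γ ε m M K α h r) {u : ℝ} (hu : u ∈ Ico (0 : ℝ) 1) :
    1 + h u ≤ M * (1 - u) := by
  have hγ := H.one_lt
  obtain ⟨ξ, hξ, e⟩ := exists_hasDerivAt_eq_slope h _ hu.2
    (H.cont.mono (Icc_subset_Icc hu.1 le_rfl))
    (fun z hz => H.deriv z ⟨hu.1.trans_lt hz.1, hz.2⟩)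
  have hξ' : ξ ∈ Ioo (0 : ℝ) 1 := ⟨hu.1.trans_lt hξ.1, hξ.2⟩
  rw [H.one, eq_div_iff (by linarith [hu.2])] at e
  have h1 : ξ ^ (γ - 1) * r ξ ≤ M := by
    have := Real.rpow_le_one hξ'.1.le hξ'.2.le (by linarith : 0 ≤ γ - 1)
    have := H.lower ξ hξ'
    have := H.upper ξ hξ'
    have := H.m_pos
    nlinarith
  nlinarith [hu.2]

theorem holder_top (H : HalfBranch γ ε m M K α h r) {u v : ℝ} (hu : u ∈ Ioo (0 : ℝ) 1)
    (hv : v ∈ Ioo (0 : ℝ) 1) :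
    |(1 + ε - h u) / u ^ γ - (1 + ε - h v) / v ^ γ| ≤ K * |u - v| ^ α :=
  abs_div_rpow_sub_le (φ := fun u => 1 + ε - h u) H.one_lt.le H.K_nonneg H.α_pos
    (continuousOn_const.sub H.cont) (by simp [H.zero])
    (fun z hz => ((H.deriv z hz).const_sub (1 + ε)).congr_deriv (neg_neg _)) H.holder hu hv

theorem holder_bot (H : HalfBranch γ ε m M K α h r) {u v : ℝ} (hu : u ∈ Ioo (0 : ℝ) 1)
    (hv : v ∈ Ioo (0 : ℝ) 1) :
    |(1 + h u) / (1 - u) - (1 + h v) / (1 - v)| ≤ K * |u - v| ^ α := by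
  have hm : ∀ z ∈ Ioo (0 : ℝ) 1, 1 - z ∈ Ioo (0 : ℝ) 1 := fun z hz =>
    ⟨by linarith [hz.2], by linarith [hz.1]⟩
  have key := abs_div_rpow_sub_le (φ := fun u => 1 + h (1 - u)) (p := 1)
    (r := fun z => (1 - z) ^ (γ - 1) * r (1 - z)) le_rfl H.K_nonneg H.α_pos
    (continuousOn_const.add (H.cont.comp (continuousOn_const.sub continuousOn_id)
      fun z hz => ⟨by linarith [hz.2], by linarith [hz.1]⟩)) (by simp [H.one])
    (fun z hz => by
      refine (((H.deriv (1 - z) (hm z hz)).comp z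
        ((hasDerivAt_id z).const_sub 1)).const_add 1).congr_deriv ?_
      simp)
    (fun a ha b hb => by
      have := H.holder_deriv _ (hm a ha) _ (hm b hb)
      rwa [show (1 - a) - (1 - b) = -(a - b) by ring, abs_neg] at this)
    (hm u hu) (hm v hv)
  simpa [abs_sub_comm] using key

theorem log_deriv_sub_le (H : HalfBranch γ ε m M K α h r) {u v : ℝ} (hu : u ∈ Ioo (0 : ℝ) 1)
    (hv : v ∈ Ioo (0 : ℝ) 1) :
    |Real.log (u ^ (γ - 1) * r u) - Real.log (v ^ (γ - 1) * r v)
      - (γ - 1) / γ * (Real.log (1 + ε - h u) - Real.log (1 + ε - h v))|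
      ≤ γ * (K / m) * |u - v| ^ α := by
  have hγ := H.one_lt
  have hm := H.m_pos
  have hK := H.K_nonneg
  have hlow : ∀ z ∈ Ioo (0 : ℝ) 1, m / γ ≤ (1 + ε - h z) / z ^ γ := fun z hz =>
    (le_div_iff₀ (Real.rpow_pos_of_pos hz.1 _)).2 (H.lower_top ⟨hz.1, hz.2.le⟩)
  have expand : ∀ z ∈ Ioo (0 : ℝ) 1,
      Real.log (z ^ (γ - 1) * r z) - (γ - 1) / γ * Real.log (1 + ε - h z)
        = Real.log (r z) - (γ - 1) / γ * Real.log ((1 + ε - h z) / z ^ γ) := fun z hz => by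
    have hz' : 0 < z ^ γ := Real.rpow_pos_of_pos hz.1 _
    have h1 : 0 < 1 + ε - h z :=
      (show (0 : ℝ) < m / γ * z ^ γ by positivity).trans_le (H.lower_top ⟨hz.1, hz.2.le⟩)
    rw [Real.log_mul (Real.rpow_pos_of_pos hz.1 _).ne' (hm.trans_le (H.lower z hz)).ne',
      Real.log_div h1.ne' hz'.ne', Real.log_rpow hz.1, Real.log_rpow hz.1]
    field_simp
    ring
  have e1 := abs_log_sub_log_le hm (H.lower u hu) (H.lower v hv)
  have e2 := abs_log_sub_log_le (by positivity) (hlow u hu) (hlow v hv)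
  have e3 := H.holder u hu v hv
  have e4 := H.holder_top hu hv
  rw [show Real.log (u ^ (γ - 1) * r u) - Real.log (v ^ (γ - 1) * r v)
      - (γ - 1) / γ * (Real.log (1 + ε - h u) - Real.log (1 + ε - h v))
      = (Real.log (r u) - Real.log (r v)) - (γ - 1) / γ *
        (Real.log ((1 + ε - h u) / u ^ γ) - Real.log ((1 + ε - h v) / v ^ γ)) by
    linear_combination expand u hu - expand v hv]
  refine (abs_sub _ _).trans ?_
  rw [abs_mul, abs_of_pos (div_pos (by linarith) (by linarith) : 0 < (γ - 1) / γ)]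
  have e5 : |Real.log (r u) - Real.log (r v)| ≤ K * |u - v| ^ α / m := e1.trans (by gcongr)
  have e6 : |Real.log ((1 + ε - h u) / u ^ γ) - Real.log ((1 + ε - h v) / v ^ γ)|
      ≤ K * |u - v| ^ α / (m / γ) := e2.trans (by gcongr)
  have hβ : 0 ≤ (γ - 1) / γ := div_nonneg (by linarith) (by linarith)
  calc _ ≤ K * |u - v| ^ α / m + (γ - 1) / γ * (K * |u - v| ^ α / (m / γ)) := by gcongr
    _ = _ := by field_simp; ring

theorem log_bot_sub_le (H : HalfBranch γ ε m M K α h r) {u v : ℝ} (hu : u ∈ Ioo (0 : ℝ) 1)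
    (hv : v ∈ Ioo (0 : ℝ) 1) :
    |Real.log (1 + h u) - Real.log (1 + h v) - (Real.log (1 - u) - Real.log (1 - v))|
      ≤ γ * (K / m) * |u - v| ^ α := by
  have hγ := H.one_lt
  have hm := H.m_pos
  have hlow : ∀ z ∈ Ioo (0 : ℝ) 1, m / γ ≤ (1 + h z) / (1 - z) := fun z hz =>
    (le_div_iff₀ (by linarith [hz.2])).2 (H.lower_bot hz)
  have expand : ∀ z ∈ Ioo (0 : ℝ) 1,
      Real.log (1 + h z) - Real.log (1 - z) = Real.log ((1 + h z) / (1 - z)) := fun z hz => by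
    have hz' : 0 < 1 - z := by linarith [hz.2]
    have h1 : 0 < 1 + h z :=
      (show (0 : ℝ) < m / γ * (1 - z) by positivity).trans_le (H.lower_bot hz)
    rw [Real.log_div h1.ne' hz'.ne']
  have e2 := abs_log_sub_log_le (by positivity) (hlow u hu) (hlow v hv)
  rw [← expand u hu, ← expand v hv] at e2
  rw [show Real.log (1 + h u) - Real.log (1 + h v) - (Real.log (1 - u) - Real.log (1 - v))
    = Real.log (1 + h u) - Real.log (1 - u) - (Real.log (1 + h v) - Real.log (1 - v)) by ring]
  calc _ ≤ |(1 + h u) / (1 - u) - (1 + h v) / (1 - v)| / (m / γ) := e2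
    _ ≤ K * |u - v| ^ α / (m / γ) := by gcongr; exact H.holder_bot hu hv
    _ = _ := by field_simp

end HalfBranch

/-! ### Folding maps and their inverse branches -/

/-- The sign of the side of the turning point on which the branch `b` lives. -/
def side (b : Bool) : ℝ := if b then 1 else -1

theorem side_mul_side (b : Bool) : side b * side b = 1 := by cases b <;> simp [side]

theorem side_mul_side_mul (b : Bool) (x : ℝ) : side b * (side b * x) = x := by
  rw [← mul_assoc, side_mul_side, one_mul]

theorem abs_side_mul (b : Bool) (x : ℝ) : |side b * x| = |x| := by cases b <;> simp [side]

theorem side_mul_mem {b : Bool} {u : ℝ} (hu : u ∈ Icc (0 : ℝ) 1) :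
    side b * u ∈ Icc (-1 : ℝ) 1 := by
  rw [mem_Icc, ← abs_le, abs_side_mul, abs_le]
  exact ⟨by linarith [hu.1], hu.2⟩

theorem branch_eq_invFunOn (f : ℝ → ℝ) (b : Bool) :
    branch f b = Function.invFunOn f {x | side b * x ∈ Icc (0 : ℝ) 1} := by
  cases b
  · have : {x : ℝ | side false * x ∈ Icc (0 : ℝ) 1} = Icc (-1) 0 := by
      ext x; simp only [side, mem_ofPred_eq, mem_Icc]
      constructor <;> rintro ⟨h1, h2⟩ <;> constructor <;> norm_num at * <;> linarith
    rw [this]; rfl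
  · have : {x : ℝ | side true * x ∈ Icc (0 : ℝ) 1} = Icc 0 1 := by
      ext x; simp [side]
    rw [this]; rfl

structure FoldMap (γ ε m M K α : ℝ) (f : ℝ → ℝ) (r : Bool → ℝ → ℝ) : Prop where
  eps_nonneg : 0 ≤ ε
  half : ∀ b, HalfBranch γ ε m M K α (fun u => f (side b * u)) (r b)

namespace FoldMap

variable {γ ε m M K α : ℝ} {f : ℝ → ℝ} {r : Bool → ℝ → ℝ}

theorem apply_zero (H : FoldMap γ ε m M K α f r) : f 0 = 1 + ε := by
  simpa using (H.half true).zero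

theorem apply_side (H : FoldMap γ ε m M K α f r) (b : Bool) : f (side b) = -1 := by
  simpa using (H.half b).one

theorem exists_apply_eq (H : FoldMap γ ε m M K α f r) (b : Bool) {t : ℝ}
    (ht : t ∈ Icc (-1 : ℝ) 1) : ∃ x ∈ {x | side b * x ∈ Icc (0 : ℝ) 1}, f x = t := by
  have hε := H.eps_nonneg
  obtain ⟨u, hu, e⟩ := intermediate_value_Icc' zero_le_one (H.half b).cont
    (show t ∈ Icc (f (side b * 1)) (f (side b * 0)) by
      rw [(H.half b).one, (H.half b).zero]
      exact ⟨ht.1, by linarith [ht.2]⟩)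
  exact ⟨side b * u, by rwa [mem_ofPred_eq, side_mul_side_mul], e⟩

theorem side_mul_branch_mem (H : FoldMap γ ε m M K α f r) (b : Bool) {t : ℝ}
    (ht : t ∈ Icc (-1 : ℝ) 1) : side b * branch f b t ∈ Icc (0 : ℝ) 1 := by
  rw [branch_eq_invFunOn]
  exact Function.invFunOn_mem (H.exists_apply_eq b ht)

theorem apply_branch (H : FoldMap γ ε m M K α f r) (b : Bool) {t : ℝ}
    (ht : t ∈ Icc (-1 : ℝ) 1) : f (branch f b t) = t := by
  rw [branch_eq_invFunOn]
  exact Function.invFunOn_eq (H.exists_apply_eq b ht)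

theorem branch_mem (H : FoldMap γ ε m M K α f r) (b : Bool) {t : ℝ}
    (ht : t ∈ Icc (-1 : ℝ) 1) : branch f b t ∈ Icc (-1 : ℝ) 1 := by
  simpa [side_mul_side_mul] using side_mul_mem (b := b) (H.side_mul_branch_mem b ht)

theorem half_apply_branch (H : FoldMap γ ε m M K α f r) (b : Bool) {t : ℝ}
    (ht : t ∈ Icc (-1 : ℝ) 1) : f (side b * (side b * branch f b t)) = t := by
  rw [side_mul_side_mul, H.apply_branch b ht]

theorem branch_injOn (H : FoldMap γ ε m M K α f r) (b : Bool) :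
    InjOn (branch f b) (Icc (-1) 1) := fun s hs t ht e => by
  rw [← H.apply_branch b hs, e, H.apply_branch b ht]

theorem injOn_half (H : FoldMap γ ε m M K α f r) (b : Bool) :
    InjOn f {x | side b * x ∈ Icc (0 : ℝ) 1} := fun x hx y hy e => by
  have := (H.half b).strictAntiOn.injOn hx hy
    (by simpa only [side_mul_side_mul] using e)
  rw [← side_mul_side_mul b x, this, side_mul_side_mul]

theorem branch_apply (H : FoldMap γ ε m M K α f r) {b : Bool} {x : ℝ}
    (hx : side b * x ∈ Icc (0 : ℝ) 1) (hfx : f x ∈ Icc (-1 : ℝ) 1) : branch f b (f x) = x :=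
  H.injOn_half b (H.side_mul_branch_mem b hfx) hx (H.apply_branch b hfx)

theorem side_mul_branch_mem_Ioo (H : FoldMap γ ε m M K α f r) (b : Bool) {t : ℝ}
    (ht : t ∈ Ioo (-1 : ℝ) 1) : side b * branch f b t ∈ Ioo (0 : ℝ) 1 := by
  have hε := H.eps_nonneg
  have ht' := Ioo_subset_Icc_self ht
  have hmem := H.side_mul_branch_mem b ht'
  have hval := H.half_apply_branch b ht'
  refine ⟨hmem.1.lt_of_ne fun e => ?_, hmem.2.lt_of_ne fun e => ?_⟩
  · rw [← e, (H.half b).zero] at hval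
    linarith [ht.2]
  · rw [e, (H.half b).one] at hval
    linarith [ht.1]

theorem branch_mem_Ioo (H : FoldMap γ ε m M K α f r) (b : Bool) {t : ℝ}
    (ht : t ∈ Ioo (-1 : ℝ) 1) : branch f b t ∈ Ioo (-1 : ℝ) 1 := by
  have h := H.side_mul_branch_mem_Ioo b ht
  rw [mem_Ioo, ← abs_lt, ← abs_side_mul b, abs_lt]
  exact ⟨by linarith [h.1], h.2⟩

theorem continuousOn (H : FoldMap γ ε m M K α f r) (b : Bool) :
    ContinuousOn f {x | side b * x ∈ Icc (0 : ℝ) 1} := by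
  have := (H.half b).cont.comp (t := Icc 0 1) (s := {x | side b * x ∈ Icc (0 : ℝ) 1})
    (f := fun x => side b * x) (continuousOn_const.mul continuousOn_id) (fun x hx => hx)
  exact this.congr fun x _ => by simp [side_mul_side_mul]

theorem isCompact_half (b : Bool) : IsCompact {x : ℝ | side b * x ∈ Icc (0 : ℝ) 1} := by
  have : {x : ℝ | side b * x ∈ Icc (0 : ℝ) 1} = (fun u => side b * u) '' Icc 0 1 := by
    ext x
    constructor
    · exact fun hx => ⟨_, hx, side_mul_side_mul b x⟩
    · rintro ⟨u, hu, rfl⟩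
      rwa [mem_ofPred_eq, side_mul_side_mul]
  rw [this]
  exact isCompact_Icc.image (continuous_const.mul continuous_id)

theorem continuousOn_branch (H : FoldMap γ ε m M K α f r) (b : Bool) :
    ContinuousOn (branch f b) (Icc (-1) 1) := by
  refine continuousOn_iff_isClosed.2 fun C hC => ?_
  refine ⟨f '' ({x | side b * x ∈ Icc (0 : ℝ) 1} ∩ C),
    (((isCompact_half b).inter_right hC).image_of_continuousOn
      ((H.continuousOn b).mono inter_subset_left)).isClosed, ?_⟩
  ext t
  constructor
  · rintro ⟨htC, ht⟩
    exact ⟨⟨_, ⟨H.side_mul_branch_mem b ht, htC⟩, H.apply_branch b ht⟩, ht⟩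
  · rintro ⟨⟨x, ⟨hx, hxC⟩, rfl⟩, ht⟩
    exact ⟨by rwa [mem_preimage, H.branch_apply hx ht], ht⟩

theorem hasDerivAt_branch (H : FoldMap γ ε m M K α f r) (b : Bool) {t : ℝ}
    (ht : t ∈ Ioo (-1 : ℝ) 1) :
    HasDerivAt (branch f b) (-(side b * ((side b * branch f b t) ^ (γ - 1) *
      r b (side b * branch f b t)))⁻¹) t := by
  have hu := H.side_mul_branch_mem_Ioo b ht
  have hpos := mul_pos (Real.rpow_pos_of_pos hu.1 (γ - 1))
    ((H.half b).m_pos.trans_le ((H.half b).lower _ hu))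
  have hd : HasDerivAt f (-(side b * ((side b * branch f b t) ^ (γ - 1) *
      r b (side b * branch f b t)))) (branch f b t) := by
    have h1 := ((H.half b).deriv _ hu).comp (branch f b t)
      ((hasDerivAt_id (branch f b t)).const_mul (side b))
    have h2 : (fun u => f (side b * u)) ∘ HMul.hMul (side b) = f := by
      funext y; simp [side_mul_side_mul]
    rw [h2] at h1
    exact h1.congr_deriv (by ring)
  have hne : side b ≠ 0 := fun e => by simpa [e] using side_mul_side b
  have := HasDerivAt.of_local_left_inverse
    ((H.continuousOn_branch b).continuousAt (Icc_mem_nhds ht.1 ht.2)) hd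
    (neg_ne_zero.2 (mul_ne_zero hne hpos.ne'))
    (Filter.mem_of_superset (Icc_mem_nhds ht.1 ht.2) fun y hy => H.apply_branch b hy)
  rwa [inv_neg] at this

/-! ### Compositions of inverse branches -/

theorem gw_mem (H : FoldMap γ ε m M K α f r) (w : List Bool) {t : ℝ}
    (ht : t ∈ Icc (-1 : ℝ) 1) : gw f w t ∈ Icc (-1 : ℝ) 1 := by
  induction w with
  | nil => exact ht
  | cons b w ih => exact H.branch_mem b ih

theorem gw_mem_Ioo (H : FoldMap γ ε m M K α f r) (w : List Bool) {t : ℝ}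
    (ht : t ∈ Ioo (-1 : ℝ) 1) : gw f w t ∈ Ioo (-1 : ℝ) 1 := by
  induction w with
  | nil => exact ht
  | cons b w ih => exact H.branch_mem_Ioo b ih

theorem gw_injOn (H : FoldMap γ ε m M K α f r) (w : List Bool) :
    InjOn (gw f w) (Icc (-1) 1) := by
  induction w with
  | nil => exact injOn_id _
  | cons b w ih => exact (H.branch_injOn b).comp ih fun t ht => H.gw_mem w ht

theorem continuousOn_gw (H : FoldMap γ ε m M K α f r) (w : List Bool) :
    ContinuousOn (gw f w) (Icc (-1) 1) := by
  induction w with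
  | nil => exact continuousOn_id
  | cons b w ih => exact (H.continuousOn_branch b).comp ih fun t ht => H.gw_mem w ht

/-- The absolute value of the derivative of `gw f w`. -/
noncomputable def derivGw (γ : ℝ) (f : ℝ → ℝ) (r : Bool → ℝ → ℝ) : List Bool → ℝ → ℝ
  | [], _ => 1
  | b :: w, t => ((side b * gw f (b :: w) t) ^ (γ - 1) * r b (side b * gw f (b :: w) t))⁻¹ *
      derivGw γ f r w t

theorem derivGw_pos (H : FoldMap γ ε m M K α f r) (w : List Bool) {t : ℝ}
    (ht : t ∈ Ioo (-1 : ℝ) 1) : 0 < derivGw γ f r w t := by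
  induction w with
  | nil => exact one_pos
  | cons b w ih =>
    have hu := H.side_mul_branch_mem_Ioo b (H.gw_mem_Ioo w ht)
    exact mul_pos (inv_pos.2 (mul_pos (Real.rpow_pos_of_pos hu.1 (γ - 1))
      ((H.half b).m_pos.trans_le ((H.half b).lower _ hu)))) ih

/-- The orientation character of `gw f w`. -/
noncomputable def orient : List Bool → ℝ
  | [] => 1
  | b :: w => -(side b * orient w)

theorem abs_orient (w : List Bool) : |orient w| = 1 := by
  induction w with
  | nil => exact abs_one
  | cons b w ih => rw [orient, abs_neg, abs_side_mul, ih]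

theorem hasDerivAt_gw (H : FoldMap γ ε m M K α f r) (w : List Bool) {t : ℝ}
    (ht : t ∈ Ioo (-1 : ℝ) 1) :
    HasDerivAt (gw f w) (orient w * derivGw γ f r w t) t := by
  induction w with
  | nil => simpa [orient, derivGw] using! hasDerivAt_id t
  | cons b w ih =>
    refine ((H.hasDerivAt_branch b (H.gw_mem_Ioo w ht)).comp t ih).congr_deriv ?_
    have hs : (side b)⁻¹ = side b := inv_eq_of_mul_eq_one_left (side_mul_side b)
    rw [orient, derivGw, mul_inv, hs]
    simp only [gw, Function.comp_apply]
    ring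

theorem exists_abs_gw_sub (H : FoldMap γ ε m M K α f r) (w : List Bool) {c d : ℝ}
    (hc : -1 ≤ c) (hcd : c < d) (hd : d ≤ 1) :
    ∃ ξ ∈ Ioo c d, |gw f w d - gw f w c| = derivGw γ f r w ξ * (d - c) := by
  obtain ⟨ξ, hξ, e⟩ := exists_hasDerivAt_eq_slope (gw f w) _ hcd
    ((H.continuousOn_gw w).mono (Icc_subset_Icc hc hd))
    (fun z hz => H.hasDerivAt_gw w ⟨hc.trans_lt hz.1, hz.2.trans_le hd⟩)
  refine ⟨ξ, hξ, ?_⟩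
  rw [eq_div_iff (by linarith)] at e
  rw [← e, abs_mul, abs_mul, abs_orient, one_mul, abs_of_pos (sub_pos.2 hcd),
    abs_of_pos (H.derivGw_pos w ⟨hc.trans_lt hξ.1, hξ.2.trans_le hd⟩)]

end FoldMap

/-! ### Bounded distortion -/

theorem min_zero_sub_le {a b e : ℝ} (h : |a - b| ≤ e) : min 0 b - e ≤ min 0 a := by
  have := abs_le.1 h
  rcases min_cases 0 b with h1 | h1 <;> rcases min_cases 0 a with h2 | h2 <;> linarith

theorem max_zero_le_add {a b e : ℝ} (h : |a - b| ≤ e) : max 0 a ≤ max 0 b + e := by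
  have := abs_le.1 h
  rcases max_cases 0 b with h1 | h1 <;> rcases max_cases 0 a with h2 | h2 <;> linarith

theorem log_add_sub_log_add_bounds {ε a b : ℝ} (hε : 0 ≤ ε) (ha : 0 < a) (hb : 0 < b) :
    min 0 (Real.log a - Real.log b) ≤ Real.log (ε + a) - Real.log (ε + b) ∧
      Real.log (ε + a) - Real.log (ε + b) ≤ max 0 (Real.log a - Real.log b) := by
  have ha' : 0 < ε + a := by linarith
  have hb' : 0 < ε + b := by linarith
  rw [← Real.log_div ha.ne' hb.ne', ← Real.log_div ha'.ne' hb'.ne']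
  rcases le_total a b with h | h
  · refine ⟨min_le_of_right_le (Real.log_le_log (by positivity) ?_),
      le_max_of_le_left (Real.log_nonpos (by positivity) ?_)⟩
    · rw [div_le_div_iff₀ hb hb']
      nlinarith
    · rw [div_le_one hb']
      linarith
  · refine ⟨min_le_of_left_le (Real.log_nonneg ?_),
      le_max_of_le_right (Real.log_le_log (by positivity) ?_)⟩
    · rw [one_le_div hb']
      linarith
    · rw [div_le_div_iff₀ hb' hb]
      nlinarith

namespace FoldMap

variable {γ ε m M K α : ℝ} {f : ℝ → ℝ} {r : Bool → ℝ → ℝ}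

/-- Logarithmic distortion of the distance to the right endpoint of `[-1, 1]`. -/
noncomputable def distR (f : ℝ → ℝ) (w : List Bool) (s t : ℝ) : ℝ :=
  Real.log (1 - gw f w t) - Real.log (1 - gw f w s)

/-- Logarithmic distortion of the distance to the left endpoint of `[-1, 1]`. -/
noncomputable def distL (f : ℝ → ℝ) (w : List Bool) (s t : ℝ) : ℝ :=
  Real.log (1 + gw f w t) - Real.log (1 + gw f w s)

/-- Logarithmic distortion of the derivative of `gw f w`. -/
noncomputable def distD (γ : ℝ) (f : ℝ → ℝ) (r : Bool → ℝ → ℝ) (w : List Bool) (s t : ℝ) : ℝ :=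
  Real.log (derivGw γ f r w t) - Real.log (derivGw γ f r w s)

theorem distD_cons (H : FoldMap γ ε m M K α f r) (b : Bool) (w : List Bool) {s t : ℝ}
    (hs : s ∈ Ioo (-1 : ℝ) 1) (ht : t ∈ Ioo (-1 : ℝ) 1) :
    |distD γ f r w s t - distD γ f r (b :: w) s t
      - (γ - 1) / γ * (Real.log (ε + (1 - gw f w t)) - Real.log (ε + (1 - gw f w s)))|
      ≤ γ * (K / m) * |gw f (b :: w) t - gw f (b :: w) s| ^ α := by
  have expand : ∀ x ∈ Ioo (-1 : ℝ) 1, Real.log (derivGw γ f r (b :: w) x)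
      = Real.log (derivGw γ f r w x) - Real.log ((side b * gw f (b :: w) x) ^ (γ - 1) *
        r b (side b * gw f (b :: w) x)) := fun x hx => by
    have hu : side b * gw f (b :: w) x ∈ Ioo (0 : ℝ) 1 :=
      H.side_mul_branch_mem_Ioo b (H.gw_mem_Ioo w hx)
    have hpos := mul_pos (Real.rpow_pos_of_pos hu.1 (γ - 1))
      ((H.half b).m_pos.trans_le ((H.half b).lower _ hu))
    rw [derivGw, Real.log_mul (inv_ne_zero hpos.ne') (H.derivGw_pos w hx).ne', Real.log_inv]
    ring
  have key := (H.half b).log_deriv_sub_le (H.side_mul_branch_mem_Ioo b (H.gw_mem_Ioo w ht))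
    (H.side_mul_branch_mem_Ioo b (H.gw_mem_Ioo w hs))
  rw [H.half_apply_branch b (Ioo_subset_Icc_self (H.gw_mem_Ioo w ht)),
    H.half_apply_branch b (Ioo_subset_Icc_self (H.gw_mem_Ioo w hs)), ← mul_sub,
    abs_side_mul] at key
  rw [distD, distD, expand t ht, expand s hs]
  refine (le_of_eq ?_).trans key
  congr 1
  simp only [gw, Function.comp_apply]
  rw [show ε + (1 - gw f w t) = 1 + ε - gw f w t by ring,
    show ε + (1 - gw f w s) = 1 + ε - gw f w s by ring]
  ring

theorem log_one_sub_side (H : FoldMap γ ε m M K α f r) (b : Bool) (w : List Bool) {s t : ℝ}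
    (hs : s ∈ Ioo (-1 : ℝ) 1) (ht : t ∈ Ioo (-1 : ℝ) 1) :
    |Real.log (1 - side b * gw f (b :: w) t) - Real.log (1 - side b * gw f (b :: w) s)
      - distL f w s t|
      ≤ γ * (K / m) * |gw f (b :: w) t - gw f (b :: w) s| ^ α := by
  have key := (H.half b).log_bot_sub_le (H.side_mul_branch_mem_Ioo b (H.gw_mem_Ioo w ht))
    (H.side_mul_branch_mem_Ioo b (H.gw_mem_Ioo w hs))
  rw [H.half_apply_branch b (Ioo_subset_Icc_self (H.gw_mem_Ioo w ht)),
    H.half_apply_branch b (Ioo_subset_Icc_self (H.gw_mem_Ioo w hs)), ← mul_sub,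
    abs_side_mul] at key
  rw [abs_sub_comm]
  exact key

theorem log_one_add_side (H : FoldMap γ ε m M K α f r) (b : Bool) (w : List Bool) {s t : ℝ}
    (hs : s ∈ Ioo (-1 : ℝ) 1) (ht : t ∈ Ioo (-1 : ℝ) 1) :
    |Real.log (1 + side b * gw f (b :: w) t) - Real.log (1 + side b * gw f (b :: w) s)|
      ≤ |gw f (b :: w) t - gw f (b :: w) s| := by
  have ht' : side b * gw f (b :: w) t ∈ Ioo (0 : ℝ) 1 :=
    H.side_mul_branch_mem_Ioo b (H.gw_mem_Ioo w ht)
  have hs' : side b * gw f (b :: w) s ∈ Ioo (0 : ℝ) 1 :=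
    H.side_mul_branch_mem_Ioo b (H.gw_mem_Ioo w hs)
  refine (abs_log_sub_log_le one_pos (by linarith [ht'.1]) (by linarith [hs'.1])).trans ?_
  rw [div_one, add_sub_add_left_eq_sub, ← mul_sub, abs_side_mul]

/-- Adding a letter in front of a word moves the distortions at the two endpoints of `[-1, 1]`
to the left endpoint, and to the turning point, respectively. -/
theorem dist_cons (H : FoldMap γ ε m M K α f r) (b : Bool) (w : List Bool) {s t e : ℝ}
    (hs : s ∈ Ioo (-1 : ℝ) 1) (ht : t ∈ Ioo (-1 : ℝ) 1)
    (h₁ : γ * (K / m) * |gw f (b :: w) t - gw f (b :: w) s| ^ α ≤ e)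
    (h₂ : |gw f (b :: w) t - gw f (b :: w) s| ≤ e) :
    (|distL f (b :: w) s t - distL f w s t| ≤ e ∧ |distR f (b :: w) s t| ≤ e) ∨
      (|distR f (b :: w) s t - distL f w s t| ≤ e ∧ |distL f (b :: w) s t| ≤ e) := by
  have k1 := (H.log_one_sub_side b w hs ht).trans h₁
  have k2 := (H.log_one_add_side b w hs ht).trans h₂
  cases b
  · left
    simp only [side, Bool.false_eq_true, if_false, neg_mul, one_mul, sub_neg_eq_add,
      ← sub_eq_add_neg] at k1 k2
    exact ⟨k1, k2⟩
  · right
    simp only [side, if_true, one_mul] at k1 k2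
    exact ⟨k1, k2⟩

theorem distortion_bounds (H : FoldMap γ ε m M K α f r) {B θ : ℝ} (hB : 0 ≤ B) (hθ : 0 < θ)
    (hθ1 : θ < 1)
    (h₁ : ∀ w, ∀ s ∈ Icc (-1 : ℝ) 1, ∀ t ∈ Icc (-1 : ℝ) 1,
      γ * (K / m) * |gw f w t - gw f w s| ^ α ≤ B * θ ^ w.length)
    (h₂ : ∀ w, ∀ s ∈ Icc (-1 : ℝ) 1, ∀ t ∈ Icc (-1 : ℝ) 1,
      |gw f w t - gw f w s| ≤ B * θ ^ w.length)
    (w : List Bool) {s t : ℝ} (hs : s ∈ Ioo (-1 : ℝ) 1) (ht : t ∈ Ioo (-1 : ℝ) 1) :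
    (γ - 1) / γ * (min 0 (distR f [] s t) + min 0 (distL f [] s t))
        - 3 * B / (1 - θ) * (1 - θ ^ w.length)
      ≤ -distD γ f r w s t + (γ - 1) / γ * (min 0 (distR f w s t) + min 0 (distL f w s t)) ∧
    -distD γ f r w s t + (γ - 1) / γ * (max 0 (distR f w s t) + max 0 (distL f w s t)) ≤
      (γ - 1) / γ * (max 0 (distR f [] s t) + max 0 (distL f [] s t))
        + 3 * B / (1 - θ) * (1 - θ ^ w.length) := by
  have hγ := (H.half true).one_lt
  set β := (γ - 1) / γ with hβ
  have hβ0 : 0 ≤ β := div_nonneg (by linarith) (by linarith)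
  have hβ1 : β ≤ 1 := (div_le_one (by linarith)).2 (by linarith)
  induction w with
  | nil => simp [distD, derivGw]
  | cons b w ih =>
    set e := B * θ ^ (b :: w).length with he
    have he0 : 0 ≤ e := by positivity
    have hQ : 3 * B / (1 - θ) * (1 - θ ^ (b :: w).length)
        ≥ 3 * B / (1 - θ) * (1 - θ ^ w.length) + 3 * e := by
      have h1 : 0 < 1 - θ := by linarith
      have : 3 * B / (1 - θ) * (1 - θ ^ (b :: w).length)
        = 3 * B / (1 - θ) * (1 - θ ^ w.length) + 3 * (B * θ ^ w.length) := by
        rw [List.length_cons, pow_succ]; field_simp; ring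
      rw [this, he, List.length_cons, pow_succ]
      have h3 : 0 ≤ B * θ ^ w.length := by positivity
      nlinarith
    have hs' := Ioo_subset_Icc_self hs
    have ht' := Ioo_subset_Icc_self ht
    have hD := abs_le.1 ((H.distD_cons b w hs ht).trans (h₁ (b :: w) s hs' t ht'))
    have hwt := H.gw_mem_Ioo w ht
    have hws := H.gw_mem_Ioo w hs
    obtain ⟨b1, b2⟩ := log_add_sub_log_add_bounds H.eps_nonneg
      (a := 1 - gw f w t) (b := 1 - gw f w s) (by linarith [hwt.2]) (by linarith [hws.2])
    have b1' := mul_le_mul_of_nonneg_left b1 hβ0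
    have b2' := mul_le_mul_of_nonneg_left b2 hβ0
    have hmin : min 0 (distL f w s t) - 2 * e
        ≤ min 0 (distR f (b :: w) s t) + min 0 (distL f (b :: w) s t) := by
      rcases H.dist_cons b w hs ht (h₁ _ s hs' t ht') (h₂ _ s hs' t ht') with ⟨x, y⟩ | ⟨x, y⟩ <;>
      · have k1 := min_zero_sub_le x
        have k2 := le_min (neg_nonpos.2 he0) (neg_le_of_abs_le y)
        linarith
    have hmax : max 0 (distR f (b :: w) s t) + max 0 (distL f (b :: w) s t)
        ≤ max 0 (distL f w s t) + 2 * e := by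
      rcases H.dist_cons b w hs ht (h₁ _ s hs' t ht') (h₂ _ s hs' t ht') with ⟨x, y⟩ | ⟨x, y⟩ <;>
      · have k1 := max_zero_le_add x
        have k2 := max_le he0 (le_of_abs_le y)
        linarith
    have hmin' := mul_le_mul_of_nonneg_left hmin hβ0
    have hmax' := mul_le_mul_of_nonneg_left hmax hβ0
    have hβe : β * e ≤ e := mul_le_of_le_one_left he0 hβ1
    obtain ⟨ih1, ih2⟩ := ih
    rw [← distR] at b1' b2'
    constructor <;> linarith [hD.1, hD.2]

end FoldMap

theorem min_zero_log_add_bounds {a b x : ℝ} (hx : x ∈ Ioo (-1 : ℝ) 1) (ha : a = 1 - x)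
    (hb : b = 1 + x) {p : ℝ} :
    Real.exp (-p * (min 0 (Real.log a) + min 0 (Real.log b))) ≤ a ^ (-p) + b ^ (-p) := by
  have ha0 : 0 < a := by linarith [hx.2]
  have hb0 : 0 < b := by linarith [hx.1]
  have hap := Real.rpow_pos_of_pos ha0 (-p)
  have hbp := Real.rpow_pos_of_pos hb0 (-p)
  rcases le_total 0 x with h | h
  · rw [min_eq_right (Real.log_nonpos ha0.le (by linarith)),
      min_eq_left (Real.log_nonneg (by linarith)), add_zero, mul_comm,
      ← Real.rpow_def_of_pos ha0]
    linarith
  · rw [min_eq_left (Real.log_nonneg (by linarith)),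
      min_eq_right (Real.log_nonpos hb0.le (by linarith)), zero_add, mul_comm,
      ← Real.rpow_def_of_pos hb0]
    linarith

namespace FoldMap

variable {γ ε m M K α : ℝ} {f : ℝ → ℝ} {r : Bool → ℝ → ℝ}

/-- The derivative of an inverse branch is bounded below by its value at the turning point, and
above by the same value times the density with power law singularities at `-1` and `1`. -/
theorem derivGw_bounds (H : FoldMap γ ε m M K α f r) {B θ : ℝ} (hB : 0 ≤ B) (hθ : 0 < θ)
    (hθ1 : θ < 1)
    (h₁ : ∀ w, ∀ s ∈ Icc (-1 : ℝ) 1, ∀ t ∈ Icc (-1 : ℝ) 1,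
      γ * (K / m) * |gw f w t - gw f w s| ^ α ≤ B * θ ^ w.length)
    (h₂ : ∀ w, ∀ s ∈ Icc (-1 : ℝ) 1, ∀ t ∈ Icc (-1 : ℝ) 1,
      |gw f w t - gw f w s| ≤ B * θ ^ w.length)
    (w : List Bool) {t : ℝ} (ht : t ∈ Ioo (-1 : ℝ) 1) :
    Real.exp (-(3 * B / (1 - θ) + 2)) * derivGw γ f r w 0 ≤ derivGw γ f r w t ∧
      derivGw γ f r w t ≤ Real.exp (3 * B / (1 - θ) + 2) * derivGw γ f r w 0 *
        ((1 - t) ^ (-((γ - 1) / γ)) + (1 + t) ^ (-((γ - 1) / γ))) := by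
  have hγ := (H.half true).one_lt
  have h0 : (0 : ℝ) ∈ Ioo (-1 : ℝ) 1 := by norm_num
  obtain ⟨k1, k2⟩ := H.distortion_bounds hB hθ hθ1 h₁ h₂ w h0 ht
  set β := (γ - 1) / γ with hβ
  have hβ0 : 0 ≤ β := div_nonneg (by linarith) (by linarith)
  have hβ1 : β ≤ 1 := (div_le_one (by linarith)).2 (by linarith)
  set Q := 3 * B / (1 - θ) with hQ
  have hQ0 : 0 ≤ Q := div_nonneg (by linarith) (by linarith)
  have hQw : Q * (1 - θ ^ w.length) ≤ Q :=
    mul_le_of_le_one_right hQ0 (by linarith [pow_pos hθ w.length])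
  have hDt := H.derivGw_pos w ht
  have hD0 := H.derivGw_pos w h0
  have hR : distR f [] 0 t = Real.log (1 - t) := by simp [distR, gw]
  have hL : distL f [] 0 t = Real.log (1 + t) := by simp [distL, gw]
  rw [hR, hL] at k1 k2
  constructor
  · have a1 : max 0 (Real.log (1 - t)) ≤ 1 := max_le zero_le_one
      ((Real.log_le_sub_one_of_pos (by linarith [ht.2])).trans (by linarith [ht.1]))
    have a2 : max 0 (Real.log (1 + t)) ≤ 1 := max_le zero_le_one
      ((Real.log_le_sub_one_of_pos (by linarith [ht.1])).trans (by linarith [ht.2]))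
    have a3 : 0 ≤ β * (max 0 (distR f w 0 t) + max 0 (distL f w 0 t)) :=
      mul_nonneg hβ0 (add_nonneg (le_max_left _ _) (le_max_left _ _))
    have a4 : β * (max 0 (Real.log (1 - t)) + max 0 (Real.log (1 + t))) ≤ 2 :=
      (mul_le_of_le_one_left (add_nonneg (le_max_left _ _) (le_max_left _ _)) hβ1).trans
        (by linarith)
    rw [← Real.log_le_log_iff (by positivity) hDt, Real.log_mul (Real.exp_pos _).ne' hD0.ne',
      Real.log_exp]
    rw [distD] at k2
    linarith
  · have a3 : β * (min 0 (distR f w 0 t) + min 0 (distL f w 0 t)) ≤ 0 :=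
      mul_nonpos_of_nonneg_of_nonpos hβ0 (add_nonpos (min_le_left _ _) (min_le_left _ _))
    have a4 := min_zero_log_add_bounds ht rfl rfl (p := β)
    refine le_trans ?_ (mul_le_mul_of_nonneg_left a4 (by positivity))
    rw [← Real.log_le_log_iff hDt (by positivity),
      Real.log_mul (by positivity) (Real.exp_pos _).ne',
      Real.log_mul (Real.exp_pos _).ne' hD0.ne', Real.log_exp, Real.log_exp]
    rw [distD] at k1
    linarith

/-- Consequence for a branch that is controlled as in `derivGw_bounds`: its image is comparable to
its derivative at the turning point. -/
theorem abs_gw_one_sub_le (H : FoldMap γ ε m M K α f r) (w : List Bool) {A : ℝ}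
    (hA : ∀ t ∈ Ioo (-1 : ℝ) 1, derivGw γ f r w t ≤
      A * ((1 - t) ^ (-((γ - 1) / γ)) + (1 + t) ^ (-((γ - 1) / γ)))) :
    |gw f w 1 - gw f w (-1)| ≤ 4 * γ * A := by
  have hγ := (H.half true).one_lt
  have hγ0 : 0 < 1 / γ := by positivity
  have hexp : 1 / γ - 1 = -((γ - 1) / γ) := by field_simp; ring
  obtain ⟨ξ, hξ, e⟩ := exists_ratio_hasDerivAt_eq_ratio_slope (gw f w) _
    (by norm_num : (-1 : ℝ) < 1) (H.continuousOn_gw w) (fun z hz => H.hasDerivAt_gw w hz)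
    (fun t => (1 + t) ^ (1 / γ) - (1 - t) ^ (1 / γ))
    (fun t => 1 / γ * ((1 - t) ^ (-((γ - 1) / γ)) + (1 + t) ^ (-((γ - 1) / γ))))
    (ContinuousOn.sub
      ((continuousOn_const.add continuousOn_id).rpow_const fun _ _ => Or.inr hγ0.le)
      ((continuousOn_const.sub continuousOn_id).rpow_const fun _ _ => Or.inr hγ0.le))
    (fun z hz => by
      have h1 := ((hasDerivAt_id z).const_add 1).rpow_const (p := 1 / γ)
        (Or.inl (by simp only [id]; linarith [hz.1]))
      have h2 := ((hasDerivAt_id z).const_sub 1).rpow_const (p := 1 / γ)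
        (Or.inl (by simp only [id]; linarith [hz.2]))
      refine (h1.sub h2).congr_deriv ?_
      rw [hexp]
      simp only [id]
      ring)
  have e' := congrArg abs e
  set P := (1 - ξ) ^ (-((γ - 1) / γ)) + (1 + ξ) ^ (-((γ - 1) / γ)) with hP
  have hP0 : 0 < P := add_pos (Real.rpow_pos_of_pos (by linarith [hξ.2]) _)
    (Real.rpow_pos_of_pos (by linarith [hξ.1]) _)
  have h2 : (2 : ℝ) ^ (1 / γ) ≤ 2 := by
    simpa using Real.rpow_le_rpow_of_exponent_le one_le_two
      ((div_le_one (by linarith)).2 hγ.le : 1 / γ ≤ 1)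
  have h2' : (0 : ℝ) < 2 ^ (1 / γ) := by positivity
  have hD := H.derivGw_pos w hξ
  rw [abs_mul, abs_mul, abs_mul, abs_orient, one_mul, abs_of_pos hD,
    abs_of_pos (mul_pos hγ0 hP0)] at e'
  norm_num only at e'
  rw [Real.zero_rpow (by positivity), sub_zero, zero_sub, sub_neg_eq_add, abs_of_pos (by linarith)]
    at e'
  have hstep : |gw f w 1 - gw f w (-1)| * (1 / γ * P) ≤ 4 * γ * A * (1 / γ * P) := by
    calc _ = (2 ^ (1 / γ) + 2 ^ (1 / γ)) * derivGw γ f r w ξ := e'.symm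
      _ ≤ 4 * derivGw γ f r w ξ := by gcongr; linarith
      _ ≤ 4 * (A * P) := by gcongr; exact hA ξ hξ
      _ = _ := by field_simp
  exact le_of_mul_le_mul_right hstep (mul_pos hγ0 hP0)

/-! ### Lengths of the intervals and of the gaps -/

theorem gw_append (f : ℝ → ℝ) (v w : List Bool) (t : ℝ) :
    gw f (v ++ w) t = gw f v (gw f w t) := by
  induction v with
  | nil => rfl
  | cons b v ih => simp [gw, ih]

theorem image_gw_Icc (H : FoldMap γ ε m M K α f r) (w : List Bool) {c d : ℝ} (hc : -1 ≤ c)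
    (hcd : c ≤ d) (hd : d ≤ 1) : gw f w '' Icc c d = uIcc (gw f w c) (gw f w d) := by
  have hsub := Icc_subset_Icc hc hd
  have hc' := (H.continuousOn_gw w).mono hsub
  refine Subset.antisymm ?_ ?_
  · rcases hc'.strictMonoOn_of_injOn_Icc' hcd ((H.gw_injOn w).mono hsub) with h | h
    · exact (h.monotoneOn.mapsTo_Icc.image_subset).trans Icc_subset_uIcc
    · exact (h.antitoneOn.mapsTo_Icc.image_subset).trans Icc_subset_uIcc'
  · have := intermediate_value_uIcc (a := c) (b := d) (f := gw f w) (by rwa [uIcc_of_le hcd])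
    rwa [uIcc_of_le hcd] at this

theorem len_image_gw_Icc (H : FoldMap γ ε m M K α f r) (w : List Bool) {c d : ℝ} (hc : -1 ≤ c)
    (hcd : c ≤ d) (hd : d ≤ 1) : len (gw f w '' Icc c d) = |gw f w d - gw f w c| := by
  rw [H.image_gw_Icc w hc hcd hd, len, Real.volume_interval, ENNReal.toReal_ofReal (abs_nonneg _)]

theorem len_Iw (H : FoldMap γ ε m M K α f r) (w : List Bool) :
    len (Iw f w) = |gw f w 1 - gw f w (-1)| :=
  H.len_image_gw_Icc w le_rfl (by norm_num) le_rfl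

theorem abs_gw_sub_le_len (H : FoldMap γ ε m M K α f r) (w : List Bool) {s t : ℝ}
    (hs : s ∈ Icc (-1 : ℝ) 1) (ht : t ∈ Icc (-1 : ℝ) 1) :
    |gw f w t - gw f w s| ≤ len (Iw f w) := by
  rw [H.len_Iw]
  have him := H.image_gw_Icc w le_rfl (by norm_num) le_rfl
  exact abs_sub_le_of_uIcc_subset_uIcc (uIcc_subset_uIcc
    (him ▸ mem_image_of_mem _ hs) (him ▸ mem_image_of_mem _ ht))

end FoldMap

namespace FoldMap

variable {γ ε m M K α : ℝ} {f : ℝ → ℝ} {r : Bool → ℝ → ℝ}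

theorem len_image_gw_Ioo (H : FoldMap γ ε m M K α f r) (w : List Bool) {c d : ℝ} (hc : -1 ≤ c)
    (hcd : c ≤ d) (hd : d ≤ 1) : len (gw f w '' Ioo c d) = |gw f w d - gw f w c| := by
  rw [← H.len_image_gw_Icc w hc hcd hd, len, len]
  congr 1
  have hinj := (H.gw_injOn w).mono (Icc_subset_Icc hc hd)
  have hsub : ({c, d} : Set ℝ) ⊆ Icc c d :=
    insert_subset ⟨le_rfl, hcd⟩ (singleton_subset_iff.2 ⟨hcd, le_rfl⟩)
  rw [← Icc_sdiff_both, hinj.image_sdiff_subset hsub]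
  have hz : volume (gw f w '' {c, d}) = 0 :=
    (((finite_singleton d).insert c).image _).measure_zero volume
  exact measure_sdiff_null hz

theorem branch_neg_one (H : FoldMap γ ε m M K α f r) (b : Bool) : branch f b (-1) = side b := by
  have h := H.branch_apply (b := b) (x := side b) (by rw [side_mul_side]; norm_num)
    (by rw [H.apply_side]; norm_num)
  rwa [H.apply_side] at h

theorem len_Iw_append (H : FoldMap γ ε m M K α f r) (w : List Bool) (b : Bool) :
    len (Iw f (w ++ [b])) = |gw f w (branch f b 1) - gw f w (side b)| := by
  rw [H.len_Iw, gw_append, gw_append]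
  simp only [gw, Function.comp_apply, id, H.branch_neg_one]

theorem side_mul_branch_one_mem (H : FoldMap γ ε m M K α f r) (hε : 0 < ε) (b : Bool) :
    side b * branch f b 1 ∈ Ioo (0 : ℝ) 1 := by
  have h1 : (1 : ℝ) ∈ Icc (-1 : ℝ) 1 := by norm_num
  have hmem := H.side_mul_branch_mem b h1
  have hval := H.half_apply_branch b h1
  refine ⟨hmem.1.lt_of_ne fun e => ?_, hmem.2.lt_of_ne fun e => ?_⟩
  · rw [← e, (H.half b).zero] at hval
    linarith
  · rw [e, (H.half b).one] at hval
    linarith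

theorem branch_one_sides (H : FoldMap γ ε m M K α f r) (hε : 0 < ε) :
    branch f false 1 ∈ Ioo (-1 : ℝ) 0 ∧ branch f true 1 ∈ Ioo (0 : ℝ) 1 := by
  have h0 := H.side_mul_branch_one_mem hε false
  have h1 := H.side_mul_branch_one_mem hε true
  simp only [side, Bool.false_eq_true, if_false, neg_mul, one_mul, if_true] at h0 h1
  exact ⟨⟨by linarith [h0.2], by linarith [h0.1]⟩, h1⟩

theorem Iw_append (f : ℝ → ℝ) (v w : List Bool) : Iw f (v ++ w) = gw f v '' Iw f w := by
  rw [Iw, Iw, image_image]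
  exact image_congr fun t _ => gw_append f v w t

theorem gap_eq (H : FoldMap γ ε m M K α f r) (hε : 0 < ε) (w : List Bool) :
    gap f w = gw f w '' Ioo (branch f false 1) (branch f true 1) := by
  obtain ⟨h0, h1⟩ := H.branch_one_sides hε
  have e : ∀ b, Iw f [b] = uIcc (side b) (branch f b 1) := fun b => by
    rw [Iw, H.image_gw_Icc [b] le_rfl (by norm_num) le_rfl]
    simp only [gw, Function.comp_apply, id, H.branch_neg_one]
  have e0 : Iw f [false] = Icc (-1) (branch f false 1) := by
    rw [e, uIcc_of_le] <;> simp only [side, Bool.false_eq_true, if_false]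
    exact h0.1.le
  have e1 : Iw f [true] = Icc (branch f true 1) 1 := by
    rw [e, uIcc_of_ge] <;> simp only [side, if_true]
    exact h1.2.le
  have hsub : Icc (-1) (branch f false 1) ∪ Icc (branch f true 1) 1 ⊆ Icc (-1) 1 :=
    union_subset (Icc_subset_Icc le_rfl (by linarith [h0.2]))
      (Icc_subset_Icc (by linarith [h1.1]) le_rfl)
  rw [gap, Iw_append, Iw_append, e0, e1, ← image_union, Iw,
    ← (H.gw_injOn w).image_sdiff_subset hsub]
  congr 1
  ext x
  simp only [Set.mem_sdiff, mem_union, mem_Icc, mem_Ioo, not_or, not_and, not_le]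
  constructor
  · rintro ⟨⟨a1, a2⟩, a3, a4⟩
    exact ⟨a3 a1, by by_contra! hx; exact absurd (a4 hx) (not_lt.2 a2)⟩
  · rintro ⟨a1, a2⟩
    exact ⟨⟨by linarith [h0.1], by linarith [h1.2]⟩, fun _ => a1, fun h => by linarith⟩

theorem side_mul_branch_one_bounds (H : FoldMap γ ε m M K α f r) (hε : 0 < ε) (b : Bool) :
    (γ / M) ^ (1 / γ) * ε ^ (1 / γ) ≤ side b * branch f b 1 ∧
      side b * branch f b 1 ≤ (γ / m) ^ (1 / γ) * ε ^ (1 / γ) ∧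
      2 / M ≤ 1 - side b * branch f b 1 := by
  have hγ := (H.half true).one_lt
  have hm := (H.half true).m_pos
  have hM : 0 < M := hm.trans_le (((H.half true).lower (1 / 2) (by norm_num)).trans
    ((H.half true).upper (1 / 2) (by norm_num)))
  have hu := H.side_mul_branch_one_mem hε b
  have hval := H.half_apply_branch b (t := 1) (by norm_num)
  have l1 := (H.half b).lower_top ⟨hu.1, hu.2.le⟩
  have l2 := (H.half b).upper_top ⟨hu.1, hu.2.le⟩
  have l3 := (H.half b).upper_bot ⟨hu.1.le, hu.2⟩
  rw [hval] at l1 l2 l3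
  set u := side b * branch f b 1
  have hroot : (u ^ γ) ^ (1 / γ) = u := by
    rw [← Real.rpow_mul hu.1.le, mul_one_div_cancel (by linarith), Real.rpow_one]
  have huγ : 0 < u ^ γ := Real.rpow_pos_of_pos hu.1 _
  refine ⟨?_, ?_, ?_⟩
  · rw [← Real.mul_rpow (by positivity) hε.le, ← hroot]
    refine Real.rpow_le_rpow (by positivity) ?_ (by positivity)
    calc γ / M * ε ≤ γ / M * (M / γ * u ^ γ) := by gcongr; linarith
      _ = u ^ γ := by field_simp
  · rw [← Real.mul_rpow (by positivity) hε.le]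
    nth_rw 1 [← hroot]
    refine Real.rpow_le_rpow (by positivity) ?_ (by positivity)
    calc u ^ γ = γ / m * (m / γ * u ^ γ) := by field_simp
      _ ≤ γ / m * ε := by gcongr; linarith
  · rw [div_le_iff₀ hM]
    linarith

/-- Uniform gap geometry for maps whose inverse branches have derivatives controlled with the
constants `E₁` and `E₂`. -/
theorem exists_gap_geometry_bound {γ m M E₁ E₂ : ℝ} (hγ : 1 < γ) (hm : 0 < m) (hM : 0 < M)
    (hE₁ : 0 < E₁) (hE₂ : 0 < E₂) :
    ∃ C > (0 : ℝ), ∀ (ε K α : ℝ) (f : ℝ → ℝ) (r : Bool → ℝ → ℝ), FoldMap γ ε m M K α f r →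
      0 < ε → ∀ w : List Bool,
      (∀ t ∈ Ioo (-1 : ℝ) 1, E₁ * derivGw γ f r w 0 ≤ derivGw γ f r w t ∧
        derivGw γ f r w t ≤ E₂ * derivGw γ f r w 0 *
          ((1 - t) ^ (-((γ - 1) / γ)) + (1 + t) ^ (-((γ - 1) / γ)))) →
      (C⁻¹ * ε ^ (1 / γ) ≤ len (gap f w) / len (Iw f w) ∧
        len (gap f w) / len (Iw f w) ≤ C * ε ^ (1 / γ)) ∧
      (∀ i : Bool, len (Iw f (w ++ [i])) / len (Iw f w) ≥ C⁻¹) := by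
  set c₁ := E₁ * (2 * (γ / M) ^ (1 / γ)) / (4 * γ * E₂) with hc₁
  set c₂ := E₂ * (2 * (2 / M) ^ (-((γ - 1) / γ))) * (2 * (γ / m) ^ (1 / γ)) / (2 * E₁) with hc₂
  set c₃ := E₁ * (2 / M) / (4 * γ * E₂) with hc₃
  have p₁ : 0 < c₁ := by positivity
  have p₂ : 0 < c₂ := by positivity
  have p₃ : 0 < c₃ := by positivity
  refine ⟨c₁⁻¹ + c₂ + c₃⁻¹, by positivity, fun ε K α f r H hε w hD => ?_⟩
  have i₁ : (c₁⁻¹ + c₂ + c₃⁻¹)⁻¹ ≤ c₁ :=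
    inv_le_of_inv_le₀ p₁ (by linarith [inv_pos.2 p₁, inv_pos.2 p₃])
  have i₂ : c₂ ≤ c₁⁻¹ + c₂ + c₃⁻¹ := by linarith [inv_pos.2 p₁, inv_pos.2 p₃]
  have i₃ : (c₁⁻¹ + c₂ + c₃⁻¹)⁻¹ ≤ c₃ :=
    inv_le_of_inv_le₀ p₃ (by linarith [inv_pos.2 p₁, inv_pos.2 p₃])
  have hβ : 0 ≤ (γ - 1) / γ := div_nonneg (by linarith) (by linarith)
  have hεγ : 0 < ε ^ (1 / γ) := by positivity
  have hD0 : 0 < derivGw γ f r w 0 := H.derivGw_pos w (by norm_num)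
  set D := derivGw γ f r w 0 with hDdef
  obtain ⟨h0, h1⟩ := H.branch_one_sides hε
  have B0 := H.side_mul_branch_one_bounds hε false
  have B1 := H.side_mul_branch_one_bounds hε true
  simp only [side, Bool.false_eq_true, if_false, neg_mul, one_mul, if_true] at B0 B1
  obtain ⟨B0l, B0u, B0e⟩ := B0
  obtain ⟨B1l, B1u, B1e⟩ := B1
  have hIu : len (Iw f w) ≤ 4 * γ * (E₂ * D) :=
    (H.len_Iw w).trans_le (H.abs_gw_one_sub_le w fun t ht => (hD t ht).2)
  have hIl : 2 * E₁ * D ≤ len (Iw f w) := by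
    obtain ⟨ξ, hξ, e⟩ := H.exists_abs_gw_sub w le_rfl (by norm_num : (-1 : ℝ) < 1) le_rfl
    rw [H.len_Iw, e]
    linarith [(hD ξ hξ).1]
  have hI0 : 0 < len (Iw f w) := lt_of_lt_of_le (by positivity) hIl
  have hgap : len (gap f w) = |gw f w (branch f true 1) - gw f w (branch f false 1)| := by
    rw [H.gap_eq hε, H.len_image_gw_Ioo w h0.1.le (by linarith [h0.2, h1.1]) h1.2.le]
  obtain ⟨ξ, hξ, e⟩ := H.exists_abs_gw_sub w h0.1.le
    (show branch f false 1 < branch f true 1 by linarith [h0.2, h1.1]) h1.2.le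
  have hξ' : ξ ∈ Ioo (-1 : ℝ) 1 := ⟨h0.1.trans hξ.1, hξ.2.trans h1.2⟩
  have hDξ := hD ξ hξ'
  refine ⟨⟨?_, ?_⟩, fun i => ?_⟩
  · rw [hgap, e, le_div_iff₀ hI0]
    calc (c₁⁻¹ + c₂ + c₃⁻¹)⁻¹ * ε ^ (1 / γ) * len (Iw f w)
        ≤ c₁ * ε ^ (1 / γ) * (4 * γ * (E₂ * D)) := by gcongr
      _ = (E₁ * D) * (2 * ((γ / M) ^ (1 / γ) * ε ^ (1 / γ))) := by
          rw [hc₁]; field_simp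
      _ ≤ derivGw γ f r w ξ * (branch f true 1 - branch f false 1) := by
          have : 0 ≤ derivGw γ f r w ξ := (H.derivGw_pos w hξ').le
          refine mul_le_mul hDξ.1 (by linarith) (by positivity) this
  · rw [hgap, e, div_le_iff₀ hI0]
    have hP : (1 - ξ) ^ (-((γ - 1) / γ)) + (1 + ξ) ^ (-((γ - 1) / γ))
        ≤ 2 * (2 / M) ^ (-((γ - 1) / γ)) := by
      have a1 := Real.rpow_le_rpow_of_nonpos (show 0 < 2 / M by positivity)
        (show 2 / M ≤ 1 - ξ by linarith [hξ.2]) (neg_nonpos.2 hβ)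
      have a2 := Real.rpow_le_rpow_of_nonpos (show 0 < 2 / M by positivity)
        (show 2 / M ≤ 1 + ξ by linarith [hξ.1]) (neg_nonpos.2 hβ)
      linarith
    calc derivGw γ f r w ξ * (branch f true 1 - branch f false 1)
        ≤ (E₂ * D * (2 * (2 / M) ^ (-((γ - 1) / γ)))) *
            (2 * ((γ / m) ^ (1 / γ) * ε ^ (1 / γ))) := by
          refine mul_le_mul (hDξ.2.trans (by gcongr)) (by linarith) (by linarith [h0.2, h1.1])
            (by positivity)
      _ = c₂ * ε ^ (1 / γ) * (2 * E₁ * D) := by rw [hc₂]; field_simp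
      _ ≤ (c₁⁻¹ + c₂ + c₃⁻¹) * ε ^ (1 / γ) * len (Iw f w) := by gcongr
  · have hsub : E₁ * D * (2 / M) ≤ len (Iw f (w ++ [i])) := by
      rw [H.len_Iw_append]
      cases i
      · obtain ⟨η, hη, e⟩ := H.exists_abs_gw_sub w le_rfl h0.1 (by linarith [h0.2])
        simp only [side, Bool.false_eq_true, if_false]
        rw [e]
        have hη' : η ∈ Ioo (-1 : ℝ) 1 := ⟨hη.1, by linarith [hη.2, h0.2]⟩
        exact mul_le_mul (hD η hη').1 (by linarith) (by positivity) (H.derivGw_pos w hη').le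
      · obtain ⟨η, hη, e⟩ := H.exists_abs_gw_sub w (by linarith [h1.1]) h1.2 le_rfl
        simp only [side, if_true]
        rw [abs_sub_comm, e]
        have hη' : η ∈ Ioo (-1 : ℝ) 1 := ⟨by linarith [hη.1, h1.1], hη.2⟩
        exact mul_le_mul (hD η hη').1 (by linarith) (by positivity) (H.derivGw_pos w hη').le
    rw [ge_iff_le, le_div_iff₀ hI0]
    calc (c₁⁻¹ + c₂ + c₃⁻¹)⁻¹ * len (Iw f w) ≤ c₃ * (4 * γ * (E₂ * D)) := by gcongr
      _ = E₁ * D * (2 / M) := by rw [hc₃]; field_simp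
      _ ≤ _ := hsub

end FoldMap

/-! ### The maximal invariant set is a Cantor set -/

theorem mem_Lambda_iff {f : ℝ → ℝ} {x : ℝ} :
    x ∈ Lambda f ↔ x ∈ Icc (-1 : ℝ) 1 ∧ f x ∈ Lambda f := by
  constructor
  · exact fun h => ⟨h 0, fun n => h (n + 1)⟩
  · rintro ⟨h0, h1⟩ (_ | n)
    exacts [h0, h1 n]

namespace FoldMap

variable {γ ε m M K α : ℝ} {f : ℝ → ℝ} {r : Bool → ℝ → ℝ}

theorem exists_side_mul_mem {x : ℝ} (hx : x ∈ Icc (-1 : ℝ) 1) :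
    ∃ b, side b * x ∈ Icc (0 : ℝ) 1 := by
  rcases le_total 0 x with h | h
  · exact ⟨true, by simpa [side] using ⟨h, hx.2⟩⟩
  · exact ⟨false, by simp only [side, mem_Icc]; constructor <;> norm_num <;> linarith [hx.1]⟩

theorem side_mem_Lambda (H : FoldMap γ ε m M K α f r) (b : Bool) : side b ∈ Lambda f := by
  have h : ∀ n, f^[n] (-1) = -1 := fun n =>
    Function.iterate_fixed (by simpa [side] using H.apply_side false) n
  rintro (_ | n)
  · cases b <;> simp [side]
  · rw [Function.iterate_succ_apply, H.apply_side, h]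
    norm_num

theorem branch_mem_Lambda (H : FoldMap γ ε m M K α f r) (b : Bool) {y : ℝ} (hy : y ∈ Lambda f) :
    branch f b y ∈ Lambda f := by
  have hy0 := (mem_Lambda_iff.1 hy).1
  exact mem_Lambda_iff.2 ⟨H.branch_mem b hy0, by rwa [H.apply_branch b hy0]⟩

theorem gw_mem_Lambda (H : FoldMap γ ε m M K α f r) (w : List Bool) {y : ℝ} (hy : y ∈ Lambda f) :
    gw f w y ∈ Lambda f := by
  induction w with
  | nil => exact hy
  | cons b w ih => exact H.branch_mem_Lambda b ih

theorem exists_gw_eq (H : FoldMap γ ε m M K α f r) (n : ℕ) {x : ℝ} (hx : x ∈ Lambda f) :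
    ∃ w : List Bool, w.length = n ∧ ∃ y ∈ Lambda f, gw f w y = x := by
  induction n generalizing x with
  | zero => exact ⟨[], rfl, x, hx, rfl⟩
  | succ n ih =>
    obtain ⟨h0, h1⟩ := mem_Lambda_iff.1 hx
    obtain ⟨b, hb⟩ := exists_side_mul_mem h0
    obtain ⟨w, hw, y, hy, e⟩ := ih h1
    refine ⟨b :: w, by simp [hw], y, hy, ?_⟩
    rw [gw, Function.comp_apply, e, H.branch_apply hb (mem_Lambda_iff.1 h1).1]

theorem iterate_mem_of_mem_Iw (H : FoldMap γ ε m M K α f r) (w : List Bool) {x : ℝ}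
    (hx : x ∈ Iw f w) : f^[w.length] x ∈ Icc (-1 : ℝ) 1 := by
  obtain ⟨t, ht, rfl⟩ := hx
  induction w with
  | nil => exact ht
  | cons b w ih =>
    rw [List.length_cons, Function.iterate_succ_apply, gw, Function.comp_apply,
      H.apply_branch b (H.gw_mem w ht)]
    exact ih

theorem Lambda_eq (H : FoldMap γ ε m M K α f r) :
    Lambda f = ⋂ n : ℕ, ⋃ w ∈ {w : List Bool | w.length = n}, Iw f w := by
  ext x
  simp only [mem_iInter, mem_iUnion₂]
  constructor
  · intro hx n
    obtain ⟨w, hw, y, hy, e⟩ := H.exists_gw_eq n hx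
    exact ⟨w, hw, y, (mem_Lambda_iff.1 hy).1, e⟩
  · intro h n
    obtain ⟨w, rfl, hx⟩ := h n
    exact H.iterate_mem_of_mem_Iw w hx

theorem isCompact_Lambda (H : FoldMap γ ε m M K α f r) : IsCompact (Lambda f) := by
  refine isCompact_Icc.of_isClosed_subset ?_ fun x hx => (mem_Lambda_iff.1 hx).1
  rw [H.Lambda_eq]
  exact isClosed_iInter fun n => (List.finite_length_eq Bool n).isClosed_biUnion fun w _ =>
    (isCompact_Icc.image_of_continuousOn (H.continuousOn_gw w)).isClosed

theorem perfect_Lambda (H : FoldMap γ ε m M K α f r) {C lam : ℝ} (hlam : lam ∈ Ioo (0 : ℝ) 1)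
    (hc : ∀ w, ∀ s ∈ Icc (-1 : ℝ) 1, ∀ t ∈ Icc (-1 : ℝ) 1,
      |gw f w t - gw f w s| ≤ C * lam ^ w.length) : Perfect (Lambda f) := by
  refine ⟨H.isCompact_Lambda.isClosed, preperfect_iff_nhds.2 fun x hx U hU => ?_⟩
  obtain ⟨δ, hδ, hball⟩ := Metric.mem_nhds_iff.1 hU
  have hlim : Tendsto (fun n : ℕ => C * lam ^ n) atTop (𝓝 0) := by
    simpa using (tendsto_pow_atTop_nhds_zero_of_lt_one hlam.1.le hlam.2).const_mul C
  obtain ⟨n, hn⟩ := (hlim.eventually (gt_mem_nhds hδ)).exists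
  obtain ⟨w, rfl, y, hy, rfl⟩ := H.exists_gw_eq n hx
  have hside : ∀ b, side b ∈ Icc (-1 : ℝ) 1 := fun b => (mem_Lambda_iff.1 (H.side_mem_Lambda b)).1
  have hmem : ∀ b, gw f w (side b) ∈ U ∩ Lambda f := fun b =>
    ⟨hball ((hc w y (mem_Lambda_iff.1 hy).1 _ (hside b)).trans_lt hn),
      H.gw_mem_Lambda w (H.side_mem_Lambda b)⟩
  by_contra! hcon
  have := H.gw_injOn w (hside true) (hside false)
    ((hcon _ (hmem true)).trans (hcon _ (hmem false)).symm)
  norm_num [side] at this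

theorem exists_subset_half (hε : 0 < ε) (H : FoldMap γ ε m M K α f r) {S : Set ℝ}
    (hS : S ⊆ Lambda f) (hpre : IsPreconnected S) :
    ∃ b, S ⊆ {x | side b * x ∈ Icc (0 : ℝ) 1} := by
  have h0 : (0 : ℝ) ∉ S := fun h => by
    have := (mem_Lambda_iff.1 (mem_Lambda_iff.1 (hS h)).2).1.2
    rw [H.apply_zero] at this
    linarith
  have hI : ∀ x ∈ S, x ∈ Icc (-1 : ℝ) 1 := fun x hx => (mem_Lambda_iff.1 (hS hx)).1
  by_cases h : ∃ x ∈ S, x < 0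
  · obtain ⟨x, hx, hx0⟩ := h
    refine ⟨false, fun y hy => ?_⟩
    have : y < 0 := not_le.1 fun hy0 => h0 (hpre.ordConnected.out hx hy ⟨hx0.le, hy0⟩)
    simp only [side, mem_ofPred_eq, mem_Icc]
    constructor <;> norm_num <;> linarith [(hI y hy).1]
  · push Not at h
    exact ⟨true, fun y hy => by simpa [side] using ⟨h y hy, (hI y hy).2⟩⟩

theorem exists_subset_Iw (hε : 0 < ε) (H : FoldMap γ ε m M K α f r) (n : ℕ) {S : Set ℝ}
    (hS : S ⊆ Lambda f) (hpre : IsPreconnected S) :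
    ∃ w : List Bool, w.length = n ∧ S ⊆ Iw f w := by
  induction n generalizing S with
  | zero => exact ⟨[], rfl, fun x hx => ⟨x, (mem_Lambda_iff.1 (hS hx)).1, rfl⟩⟩
  | succ n ih =>
    obtain ⟨b, hb⟩ := H.exists_subset_half hε hS hpre
    obtain ⟨w, hw, hsub⟩ := ih (S := f '' S)
      (image_subset_iff.2 fun x hx => (mem_Lambda_iff.1 (hS hx)).2)
      (hpre.image f ((H.continuousOn b).mono hb))
    refine ⟨b :: w, by simp [hw], fun x hx => ?_⟩
    obtain ⟨t, ht, e⟩ := hsub (mem_image_of_mem f hx)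
    refine ⟨t, ht, ?_⟩
    rw [gw, Function.comp_apply, e,
      H.branch_apply (hb hx) (mem_Lambda_iff.1 (mem_Lambda_iff.1 (hS hx)).2).1]

theorem isTotallyDisconnected_Lambda (hε : 0 < ε) (H : FoldMap γ ε m M K α f r) {C lam : ℝ}
    (hlam : lam ∈ Ioo (0 : ℝ) 1)
    (hc : ∀ w, ∀ s ∈ Icc (-1 : ℝ) 1, ∀ t ∈ Icc (-1 : ℝ) 1,
      |gw f w t - gw f w s| ≤ C * lam ^ w.length) : IsTotallyDisconnected (Lambda f) := by
  intro S hS hpre x hx y hy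
  have hlim : Tendsto (fun n : ℕ => C * lam ^ n) atTop (𝓝 0) := by
    simpa using (tendsto_pow_atTop_nhds_zero_of_lt_one hlam.1.le hlam.2).const_mul C
  have hle : |x - y| ≤ 0 := ge_of_tendsto' hlim fun n => by
    obtain ⟨w, rfl, hsub⟩ := H.exists_subset_Iw hε n hS hpre
    obtain ⟨t, ht, rfl⟩ := hsub hx
    obtain ⟨s, hs, rfl⟩ := hsub hy
    exact hc w s hs t ht
  exact sub_eq_zero.1 (abs_nonpos_iff.1 hle)

end FoldMap

/-! ### Members of a good family are folding maps with uniform constants -/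

theorem exists_abs_bounds {X : Type*} [TopologicalSpace X] {s : Set X} (hs : IsCompact s)
    {g : X → ℝ} (hg : ContinuousOn g s) (hne : ∀ x ∈ s, g x ≠ 0) :
    ∃ m > 0, ∃ M, ∀ x ∈ s, m ≤ |g x| ∧ |g x| ≤ M := by
  rcases s.eq_empty_or_nonempty with rfl | hs'
  · exact ⟨1, one_pos, 0, by simp⟩
  obtain ⟨x, hx, hmin⟩ := hs.exists_isMinOn hs' hg.abs
  obtain ⟨y, hy, hmax⟩ := hs.exists_isMaxOn hs' hg.abs
  exact ⟨|g x|, abs_pos.2 (hne x hx), |g y|, fun z hz => ⟨hmin hz, hmax hz⟩⟩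

theorem rpow_le_rpow_of_mem_Ioo {u v a b : ℝ} (hu : u ∈ Ioo (0 : ℝ) 1) (hv : v ∈ Ioo (0 : ℝ) 1)
    (ha : 0 < a) (hab : a ≤ b) : |u - v| ^ b ≤ |u - v| ^ a :=
  Real.rpow_le_rpow_of_exponent_ge_of_imp (abs_nonneg _)
    (abs_le.2 ⟨by linarith [hu.1, hv.2], by linarith [hu.2, hv.1]⟩) hab
    fun _ h => absurd h (ha.trans_le hab).ne'

namespace GoodFamily

/-- The absolute value of the factor of the derivative of `f_ε` other than the power law, in the
coordinate `|x|` on either side of the turning point. -/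
noncomputable def factor (F : GoodFamily) (ε : ℝ) (b : Bool) (u : ℝ) : ℝ :=
  |F.f' ε (side b * u)| / u ^ (F.gamma - 1)

theorem exists_factor_bounds (F : GoodFamily) : ∃ m > 0, ∃ M, ∀ ε ∈ Icc 0 F.eps0, ∀ b,
    ∀ u ∈ Ioo (0 : ℝ) 1, m ≤ F.factor ε b u ∧ F.factor ε b u ≤ M := by
  obtain ⟨m₀, hm₀, M₀, h₀⟩ := exists_abs_bounds (isCompact_Icc.prod isCompact_Icc) F.Rneg_cont
    fun p hp => F.Rneg_ne p.1 hp.1 p.2 hp.2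
  obtain ⟨m₁, hm₁, M₁, h₁⟩ := exists_abs_bounds (isCompact_Icc.prod isCompact_Icc) F.Rpos_cont
    fun p hp => F.Rpos_ne p.1 hp.1 p.2 hp.2
  refine ⟨min m₀ m₁, lt_min hm₀ hm₁, max M₀ M₁, fun ε hε b u hu => ?_⟩
  have hup : 0 < u ^ (F.gamma - 1) := Real.rpow_pos_of_pos hu.1 _
  cases b
  · have := h₀ (ε, -u) ⟨hε, by constructor <;> linarith [hu.1, hu.2]⟩
    simp only [F.Rneg_eq ε hε (-u) ⟨by linarith [hu.2], by linarith [hu.1]⟩, abs_neg,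
      abs_of_pos hu.1, abs_div, abs_of_pos hup] at this
    simp only [factor, side, Bool.false_eq_true, if_false, neg_one_mul]
    exact ⟨(min_le_left _ _).trans this.1, this.2.trans (le_max_left _ _)⟩
  · have := h₁ (ε, u) ⟨hε, hu.1.le, hu.2.le⟩
    simp only [F.Rpos_eq ε hε u ⟨hu.1, hu.2.le⟩, abs_of_pos hu.1, abs_div, abs_of_pos hup] at this
    simp only [factor, side, if_true, one_mul]
    exact ⟨(min_le_right _ _).trans this.1, this.2.trans (le_max_right _ _)⟩

theorem factor_holder (F : GoodFamily) {ε : ℝ} (hε : ε ∈ Icc 0 F.eps0) (b : Bool) {u v : ℝ}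
    (hu : u ∈ Ioo (0 : ℝ) 1) (hv : v ∈ Ioo (0 : ℝ) 1) :
    |F.factor ε b u - F.factor ε b v| ≤ F.K'' * |u - v| ^ F.alpha'' := by
  have e : ∀ x ∈ Ioo (0 : ℝ) 1,
      F.factor ε b x = |F.f' ε (side b * x) / |side b * x| ^ (F.gamma - 1)| := fun x hx => by
    rw [abs_side_mul, abs_of_pos hx.1, abs_div, abs_of_pos (Real.rpow_pos_of_pos hx.1 _), factor]
  rw [e u hu, e v hv]
  refine (abs_abs_sub_abs_le _ _).trans ?_
  rw [← abs_side_mul b (u - v), mul_sub]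
  cases b
  · have h : ∀ x ∈ Ioo (0 : ℝ) 1, side false * x ∈ Ico (-1 : ℝ) 0 := fun x hx => by
      simp only [side, mem_Ico]; constructor <;> norm_num <;> linarith [hx.1, hx.2]
    exact F.holder''_neg ε hε _ (h u hu) _ (h v hv)
  · have h : ∀ x ∈ Ioo (0 : ℝ) 1, side true * x ∈ Ioc (0 : ℝ) 1 := fun x hx => by
      simpa [side] using ⟨hx.1, hx.2.le⟩
    exact F.holder''_pos ε hε _ (h u hu) _ (h v hv)

theorem half_strictAntiOn (F : GoodFamily) {ε : ℝ} (hε : ε ∈ Icc 0 F.eps0) (b : Bool) :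
    StrictAntiOn (fun u => F.f ε (side b * u)) (Icc 0 1) := by
  intro u hu v hv huv
  cases b
  · simp only [side, Bool.false_eq_true, if_false, neg_one_mul]
    exact F.mono ε hε ⟨by linarith [hv.2], by linarith [hv.1]⟩
      ⟨by linarith [hu.2], by linarith [hu.1]⟩ (neg_lt_neg huv)
  · simpa [side] using F.anti ε hε hu hv huv

theorem half_hasDerivAt (F : GoodFamily) {ε : ℝ} (hε : ε ∈ Icc 0 F.eps0) (b : Bool) {u : ℝ}
    (hu : u ∈ Ioo (0 : ℝ) 1) : HasDerivAt (fun u => F.f ε (side b * u))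
      (-(u ^ (F.gamma - 1) * F.factor ε b u)) u := by
  have hx := side_mul_mem (b := b) (Ioo_subset_Icc_self hu)
  have hlt : side b * u ∈ Ioo (-1 : ℝ) 1 := by
    rw [mem_Ioo, ← abs_lt, abs_side_mul, abs_of_pos hu.1]
    exact hu.2
  have hd : HasDerivAt (fun u => F.f ε (side b * u)) (F.f' ε (side b * u) * side b) u :=
    ((F.deriv_f ε hε _ hx).hasDerivAt (Icc_mem_nhds hlt.1 hlt.2)).comp u
      (by simpa using (hasDerivAt_id u).const_mul (side b))
  have hnonpos : F.f' ε (side b * u) * side b ≤ 0 := by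
    have hnhds : Icc (0 : ℝ) 1 ∈ 𝓝 u := Icc_mem_nhds hu.1 hu.2
    rw [← hd.deriv, ← derivWithin_of_mem_nhds hnhds]
    exact (F.half_strictAntiOn hε b).antitoneOn.derivWithin_nonpos
  refine hd.congr_deriv ?_
  have habs : |F.f' ε (side b * u)| = -(F.f' ε (side b * u) * side b) := by
    rw [← abs_of_nonpos hnonpos, mul_comm (F.f' ε _), abs_side_mul]
  rw [factor, mul_div_cancel₀ _ (Real.rpow_pos_of_pos hu.1 _).ne', habs, neg_neg]

theorem exists_foldMap (F : GoodFamily) : ∃ m > 0, ∃ M, ∃ K, ∃ α, 0 < α ∧ α ≤ 1 ∧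
    ∀ ε ∈ Icc 0 F.eps0, FoldMap F.gamma ε m M K α (F.f ε) (F.factor ε) := by
  obtain ⟨m, hm, M, hmM⟩ := F.exists_factor_bounds
  refine ⟨m, hm, M, F.K' + F.K'', min F.alpha' F.alpha'',
    lt_min F.alpha'_mem.1 F.alpha''_mem.1, (min_le_left _ _).trans F.alpha'_mem.2,
    fun ε hε => ⟨hε.1, fun b => ?_⟩⟩
  have hα := lt_min F.alpha'_mem.1 F.alpha''_mem.1
  have hK' := F.K'_pos
  have hK'' := F.K''_pos
  refine ⟨F.one_lt_gamma, hm, by positivity, hα, ?_, ?_, ?_, fun u hu => F.half_hasDerivAt hε b hu,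
    fun u hu => (hmM ε hε b u hu).1, fun u hu => (hmM ε hε b u hu).2,
    fun u hu v hv => ?_, fun u hu v hv => ?_⟩
  · have hc : ContinuousOn (F.f ε) (Icc (-1) 1) := fun x hx =>
      (F.deriv_f ε hε x hx).continuousWithinAt
    exact hc.comp (by fun_prop) fun u hu => side_mul_mem hu
  · simpa using F.map_zero ε hε
  · cases b
    · simpa [side] using F.map_neg_one ε hε
    · simpa [side] using F.map_one ε hε
  · refine (F.factor_holder hε b hu hv).trans ?_
    exact mul_le_mul (by linarith) (rpow_le_rpow_of_mem_Ioo hu hv hα (min_le_right _ _))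
      (by positivity) (by positivity)
  · have e : ∀ x ∈ Ioo (0 : ℝ) 1,
        x ^ (F.gamma - 1) * F.factor ε b x = |F.f' ε (side b * x)| := fun x hx => by
      rw [factor, mul_div_cancel₀ _ (Real.rpow_pos_of_pos hx.1 _).ne']
    rw [e u hu, e v hv]
    refine (abs_abs_sub_abs_le _ _).trans ((F.holder' ε hε _
      (side_mul_mem (Ioo_subset_Icc_self hu)) _ (side_mul_mem (Ioo_subset_Icc_self hv))).trans ?_)
    rw [← mul_sub, abs_side_mul]
    exact mul_le_mul (by linarith) (rpow_le_rpow_of_mem_Ioo hu hv hα (min_le_left _ _))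
      (by positivity) (by positivity)

theorem abs_gw_sub_le (F : GoodFamily) {ε m M K α : ℝ} {r : Bool → ℝ → ℝ}
    (hε : ε ∈ Icc 0 F.eps0) (H : FoldMap F.gamma ε m M K α (F.f ε) r) (w : List Bool) {s t : ℝ}
    (hs : s ∈ Icc (-1 : ℝ) 1) (ht : t ∈ Icc (-1 : ℝ) 1) :
    |gw (F.f ε) w t - gw (F.f ε) w s| ≤ (F.C0 + 2) / F.lam * F.lam ^ w.length := by
  obtain ⟨hl0, hl1⟩ := F.lam_mem
  have hC := F.C0_pos
  obtain hw | ⟨n, hn, hw⟩ : w.length ≤ 1 ∨ ∃ n, 1 ≤ n ∧ w.length = n + 1 := by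
    rcases Nat.lt_or_ge 1 w.length with h | h
    · exact Or.inr ⟨w.length - 1, by omega, by omega⟩
    · exact Or.inl h
  · have hpow : F.lam ≤ F.lam ^ w.length := by
      simpa using pow_le_pow_of_le_one hl0.le hl1.le hw
    have h2 : |gw (F.f ε) w t - gw (F.f ε) w s| ≤ 2 := by
      have a := H.gw_mem w ht
      have b := H.gw_mem w hs
      exact abs_le.2 ⟨by linarith [a.1, b.2], by linarith [a.2, b.1]⟩
    calc |gw (F.f ε) w t - gw (F.f ε) w s| ≤ F.C0 + 2 := by linarith
      _ = (F.C0 + 2) / F.lam * F.lam := by field_simp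
      _ ≤ _ := by gcongr
  · calc |gw (F.f ε) w t - gw (F.f ε) w s| ≤ len (Iw (F.f ε) w) := H.abs_gw_sub_le_len w hs ht
      _ ≤ F.C0 * F.lam ^ n := F.decay ε hε n hn w hw
      _ ≤ (F.C0 + 2) * F.lam ^ n := by gcongr; linarith
      _ = _ := by rw [hw, pow_succ]; field_simp

theorem exists_derivGw_bounds (F : GoodFamily) {m M K α : ℝ} (hm : 0 < m) (hα : 0 < α)
    (hα1 : α ≤ 1) (H : ∀ ε ∈ Icc 0 F.eps0, FoldMap F.gamma ε m M K α (F.f ε) (F.factor ε)) :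
    ∃ E > 0, ∀ ε ∈ Icc 0 F.eps0, ∀ w, ∀ t ∈ Ioo (-1 : ℝ) 1,
      E⁻¹ * FoldMap.derivGw F.gamma (F.f ε) (F.factor ε) w 0 ≤
        FoldMap.derivGw F.gamma (F.f ε) (F.factor ε) w t ∧
      FoldMap.derivGw F.gamma (F.f ε) (F.factor ε) w t ≤
        E * FoldMap.derivGw F.gamma (F.f ε) (F.factor ε) w 0 *
          ((1 - t) ^ (-((F.gamma - 1) / F.gamma)) + (1 + t) ^ (-((F.gamma - 1) / F.gamma))) := by
  obtain ⟨hl0, hl1⟩ := F.lam_mem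
  have hC := F.C0_pos
  have hγ : 0 < F.gamma := zero_lt_one.trans F.one_lt_gamma
  have hK : 0 ≤ K := ((H 0 ⟨le_rfl, F.eps0_pos.le⟩).half true).K_nonneg
  set C₁ := (F.C0 + 2) / F.lam with hC₁
  have hC₁0 : 0 < C₁ := by positivity
  set θ := F.lam ^ α with hθ
  have hθ0 : 0 < θ := Real.rpow_pos_of_pos hl0 α
  have hθ1 : θ < 1 := Real.rpow_lt_one hl0.le hl1 hα
  have hle : F.lam ≤ θ := by
    simpa using Real.rpow_le_rpow_of_exponent_ge hl0 hl1.le hα1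
  set B := F.gamma * (K / m) * C₁ ^ α + C₁ with hB
  have hB₁ : 0 ≤ F.gamma * (K / m) * C₁ ^ α := by positivity
  refine ⟨Real.exp (3 * B / (1 - θ) + 2), Real.exp_pos _, fun ε hε w t ht => ?_⟩
  have hc := fun w s (hs : s ∈ Icc (-1 : ℝ) 1) t (ht : t ∈ Icc (-1 : ℝ) 1) =>
    F.abs_gw_sub_le hε (H ε hε) w hs ht
  rw [← Real.exp_neg]
  refine (H ε hε).derivGw_bounds (by positivity) hθ0 hθ1 (fun w s hs t ht => ?_)
    (fun w s hs t ht => ?_) w ht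
  · calc F.gamma * (K / m) * |gw (F.f ε) w t - gw (F.f ε) w s| ^ α
        ≤ F.gamma * (K / m) * (C₁ * F.lam ^ w.length) ^ α := by
          have := hc w s hs t ht
          gcongr
      _ = F.gamma * (K / m) * C₁ ^ α * θ ^ w.length := by
          rw [Real.mul_rpow hC₁0.le (by positivity), ← Real.rpow_natCast, ← Real.rpow_mul hl0.le,
            hθ, ← Real.rpow_mul_natCast hl0.le, mul_comm α]
          ring
      _ ≤ B * θ ^ w.length := by gcongr; linarith
  · calc |gw (F.f ε) w t - gw (F.f ε) w s| ≤ C₁ * F.lam ^ w.length := hc w s hs t ht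
      _ ≤ B * θ ^ w.length := by gcongr; linarith

end GoodFamily

/-- Theorem B: for a good family with power-law exponent `γ`, each maximal
invariant set `Λ_ε` (`0 < ε ≤ ε₀`) is a Cantor set, and `ε^{1/γ}` determines asymptotically
the gap geometry of the family. -/
theorem cantor_sets_and_gap_geometry (F : GoodFamily) :
    (∀ ε ∈ Ioc 0 F.eps0, (Lambda (F.f ε)).Nonempty ∧ IsCompact (Lambda (F.f ε)) ∧
      Perfect (Lambda (F.f ε)) ∧ IsTotallyDisconnected (Lambda (F.f ε))) ∧
    (∃ C > (0:ℝ), ∀ ε ∈ Ioc 0 F.eps0, ∀ w : List Bool,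
      (C⁻¹ * ε ^ (1 / F.gamma) ≤ len (gap (F.f ε) w) / len (Iw (F.f ε) w) ∧
        len (gap (F.f ε) w) / len (Iw (F.f ε) w) ≤ C * ε ^ (1 / F.gamma)) ∧
      (∀ i : Bool, len (Iw (F.f ε) (w ++ [i])) / len (Iw (F.f ε) w) ≥ C⁻¹)) := by
  obtain ⟨m, hm, M, K, α, hα, hα1, H⟩ := F.exists_foldMap
  refine ⟨fun ε hε => ?_, ?_⟩
  · have Hε := H ε (Ioc_subset_Icc_self hε)
    have hc := fun w s (hs : s ∈ Icc (-1 : ℝ) 1) t (ht : t ∈ Icc (-1 : ℝ) 1) =>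
      F.abs_gw_sub_le (Ioc_subset_Icc_self hε) Hε w hs ht
    exact ⟨⟨_, Hε.side_mem_Lambda true⟩, Hε.isCompact_Lambda, Hε.perfect_Lambda F.lam_mem hc,
      Hε.isTotallyDisconnected_Lambda hε.1 F.lam_mem hc⟩
  · obtain ⟨E, hE, hbounds⟩ := F.exists_derivGw_bounds hm hα hα1 H
    have hM : 0 < M := by
      have h := (H 0 ⟨le_rfl, F.eps0_pos.le⟩).half true
      have hu : (1 / 2 : ℝ) ∈ Ioo (0 : ℝ) 1 := by norm_num
      exact hm.trans_le ((h.lower _ hu).trans (h.upper _ hu))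
    obtain ⟨C, hC, hgap⟩ := FoldMap.exists_gap_geometry_bound F.one_lt_gamma hm hM (inv_pos.2 hE) hE
    exact ⟨C, hC, fun ε hε w => hgap ε K α (F.f ε) (F.factor ε) (H ε (Ioc_subset_Icc_self hε))
      hε.1 w (hbounds ε (Ioc_subset_Icc_self hε) w)⟩
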